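/- arXiv:0710.3036 — 2 statements merged into one kernel-verified Lean document; each statement's English description precedes it below -/
import Mathlib

section
/- Let n ≥ 4, let c = (c_1,…,c_m) be a cardinality sequence in CS (i.e. m ≥ 2, 2 ≤ c_1 < ⋯ < c_m ≤ n, and c ≠ (2,3)) with c ≠ (2,n), and let i ∈ {1,…,n−1} be an internal node of D̃_n. Then the degree constraint x(δ^out(i)) ≤ 1 defines a facet of P_{0,n-path}^c(D̃_n). -/
open Finset

/-- The arc set `Ã_n` of the digraph `D̃_n` on the node set `Ñ_n = {0,1,…,n} = Fin (n+1)`: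
all arcs `(i,j)` with `i ≠ j`, except those entering `0`, those leaving `n`, and the arc
`(0,n)`.  This is exactly
`{(0,i),(i,n) : 1 ≤ i ≤ n-1} ∪ {(i,j) : 1 ≤ i,j ≤ n-1, i ≠ j}`. -/
def tA (n : ℕ) : Finset (Fin (n + 1) × Fin (n + 1)) :=
  Finset.univ.filter (fun a => a.1 ≠ a.2 ∧ a.2 ≠ 0 ∧ a.1 ≠ Fin.last n ∧
    ¬(a.1 = 0 ∧ a.2 = Fin.last n))

/-- A simple directed `(0,n)`-path in `D̃_n`, encoded by its arc set: there is an
injective map `f` from `Fin (k+1)` to the nodes with `f 0 = 0` and `f k = n` whose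
consecutive pairs are exactly the arcs of `P` (so `P` has `k` arcs). -/
def IsTildePath (n : ℕ) (P : Finset (Fin (n + 1) × Fin (n + 1))) : Prop :=
  P ⊆ tA n ∧ ∃ (k : ℕ) (f : Fin (k + 1) → Fin (n + 1)), Function.Injective f ∧
    f 0 = 0 ∧ f (Fin.last k) = Fin.last n ∧
    P = Finset.image (fun i : Fin k => (f (Fin.castSucc i), f (Fin.succ i))) Finset.univ

/-- Incidence vector of an arc set. -/
noncomputable def incVec {N : ℕ} (C : Finset (Fin N × Fin N)) : Fin N → Fin N → ℝ :=
  fun i j => if (i, j) ∈ C then 1 else 0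

/-- The cardinality constrained path polytope `P_{0,n-path}^c(D̃_n)`: the convex hull of
the incidence vectors of simple `(0,n)`-paths whose cardinality is `c p` for some `p`. -/
noncomputable def pathPolytope (n : ℕ) {m : ℕ} (c : Fin m → ℕ) :
    Set (Fin (n + 1) → Fin (n + 1) → ℝ) :=
  convexHull ℝ {x | ∃ P, IsTildePath n P ∧ (∃ p, P.card = c p) ∧ x = incVec P}

/-- `x(δ^out(i))` in `D̃_n`. -/
noncomputable def outT (n : ℕ) (x : Fin (n + 1) → Fin (n + 1) → ℝ) (i : Fin (n + 1)) :
    ℝ :=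
  ∑ a ∈ (tA n).filter (fun a => a.1 = i), x a.1 a.2

/-- `x(δ^in(i))` in `D̃_n`. -/
noncomputable def inT (n : ℕ) (x : Fin (n + 1) → Fin (n + 1) → ℝ) (i : Fin (n + 1)) :
    ℝ :=
  ∑ a ∈ (tA n).filter (fun a => a.2 = i), x a.1 a.2

/-- The dimension (of the affine hull) of a subset of a real vector space. -/
noncomputable def adim {V : Type*} [AddCommGroup V] [Module ℝ V] (P : Set V) : ℕ :=
  Module.finrank ℝ (vectorSpan ℝ P)

/-- The valid inequality `f x ≤ b` defines a facet of `P`: it is valid and its face has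
dimension `(dim P) - 1`. -/
def IsFacetLE {V : Type*} [AddCommGroup V] [Module ℝ V] (P : Set V) (f : V → ℝ) (b : ℝ) :
    Prop :=
  (∀ x ∈ P, f x ≤ b) ∧ adim {x ∈ P | f x = b} + 1 = adim P

/-- The valid inequality `f x ≥ b` defines a facet of `P`: it is valid and its face has
dimension `(dim P) - 1`. -/
def IsFacetGE {V : Type*} [AddCommGroup V] [Module ℝ V] (P : Set V) (f : V → ℝ) (b : ℝ) :
    Prop :=
  (∀ x ∈ P, b ≤ f x) ∧ adim {x ∈ P | f x = b} + 1 = adim P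

section Walks

variable {V : Type*}

/-- The arcs of the walk that starts in `u`, visits the nodes of the list and ends in `v`. -/
def walkArcs : V → List V → V → List (V × V)
  | u, [], v => [(u, v)]
  | u, x :: X, v => (u, x) :: walkArcs x X v

theorem walkArcs_append_cons (u x v : V) (A B : List V) :
    walkArcs u (A ++ x :: B) v = walkArcs u A x ++ walkArcs x B v := by
  induction A generalizing u with
  | nil => rfl
  | cons a A ih => simp [walkArcs, ih]

theorem map_fst_walkArcs (u v : V) (X : List V) :
    (walkArcs u X v).map Prod.fst = u :: X := by
  induction X generalizing u with
  | nil => rfl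
  | cons a A ih => simp [walkArcs, ih]

theorem map_snd_walkArcs (u v : V) (X : List V) :
    (walkArcs u X v).map Prod.snd = X ++ [v] := by
  induction X generalizing u with
  | nil => rfl
  | cons a A ih => simp [walkArcs, ih]

theorem length_walkArcs (u v : V) (X : List V) : (walkArcs u X v).length = X.length + 1 := by
  simpa using congrArg List.length (map_fst_walkArcs u v X)

theorem nodup_walkArcs {u v : V} {X : List V} (h : (u :: X).Nodup) :
    (walkArcs u X v).Nodup :=
  List.Nodup.of_map Prod.fst (by rwa [map_fst_walkArcs])

theorem ne_of_mem_walkArcs {u v : V} {X : List V} (h : (u :: (X ++ [v])).Nodup) {a : V × V}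
    (ha : a ∈ walkArcs u X v) : a.1 ≠ a.2 := by
  induction X generalizing u with
  | nil => simp_all [walkArcs]
  | cons x X ih =>
    rcases List.mem_cons.1 ha with rfl | ha
    · intro hux
      simp_all
    · exact ih (List.nodup_cons.1 h).2 ha

theorem walkArcs_ofFn (k : ℕ) (f : Fin (k + 2) → V) :
    walkArcs (f 0) (List.ofFn fun j : Fin k => f j.succ.castSucc) (f (Fin.last (k + 1))) =
      List.ofFn fun j : Fin (k + 1) => (f j.castSucc, f j.succ) := by
  induction k with
  | zero => simp [walkArcs]
  | succ k ih =>
    rw [List.ofFn_succ, List.ofFn_succ, walkArcs]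
    exact congrArg _ (ih fun j => f j.succ)

/-- The total weight of the arcs of a walk. -/
def walkSum (α : V → V → ℝ) (u : V) (X : List V) (v : V) : ℝ :=
  ((walkArcs u X v).map fun a => α a.1 a.2).sum

@[simp]
theorem walkSum_nil (α : V → V → ℝ) (u v : V) : walkSum α u [] v = α u v := by
  simp [walkSum, walkArcs]

@[simp]
theorem walkSum_cons (α : V → V → ℝ) (u x v : V) (X : List V) :
    walkSum α u (x :: X) v = α u x + walkSum α x X v := by
  simp [walkSum, walkArcs]

theorem walkSum_append_cons (α : V → V → ℝ) (u x v : V) (A B : List V) :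
    walkSum α u (A ++ x :: B) v = walkSum α u A x + walkSum α x B v := by
  simp [walkSum, walkArcs_append_cons]

theorem walkSum_sub_potential (α : V → V → ℝ) (π : V → ℝ) (u v : V) (X : List V) :
    walkSum (fun a b => α a b - (π b - π a)) u X v = walkSum α u X v - (π v - π u) := by
  induction X generalizing u with
  | nil => simp
  | cons x X ih => rw [walkSum_cons, walkSum_cons, ih]; ring

theorem walkSum_indicator_tail [DecidableEq V] (i u v : V) (X : List V) :
    walkSum (fun a _ => if a = i then 1 else 0) u X v = ((u :: X).count i : ℝ) := by
  induction X generalizing u with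
  | nil => simp [List.count_cons]
  | cons x X ih =>
    rw [walkSum_cons, ih, List.count_cons (b := u)]
    push_cast
    simp [add_comm]

theorem exists_nodup_list [DecidableEq V] (S E : Finset V) (r : ℕ) (h : r + E.card ≤ S.card) :
    ∃ Z : List V, Z.Nodup ∧ Z.length = r ∧ (∀ z ∈ Z, z ∈ S) ∧ ∀ z ∈ Z, z ∉ E := by
  have h1 : r ≤ (S \ E).card := by
    have := Finset.le_card_sdiff E S
    omega
  obtain ⟨T, hT, rfl⟩ := Finset.exists_subset_card_eq h1
  refine ⟨T.toList, T.nodup_toList, T.length_toList, fun z hz => ?_, fun z hz => ?_⟩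
  · exact (Finset.mem_sdiff.1 (hT (Finset.mem_toList.1 hz))).1
  · exact (Finset.mem_sdiff.1 (hT (Finset.mem_toList.1 hz))).2

/-- All walks from `o` to `t` through `i` that visit exactly `r` further nodes, all of them
different and in `S`, have weight `γ`. -/
def ConstThrough (β : V → V → ℝ) (S : Finset V) (o i t : V) (γ : ℝ) (r : ℕ) : Prop :=
  ∀ A B : List V, (A ++ B).Nodup → (∀ x ∈ A ++ B, x ∈ S) → A.length + B.length = r →
    walkSum β o A i + walkSum β i B t = γ

section Normalized

variable {β : V → V → ℝ} {S : Finset V} {o i t : V} {γ : ℝ} {r r' : ℕ}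

/-- If the weight of an arc that leaves a node of `S` depends on that node only, then the
weight of a walk is a sum of node weights. -/
theorem walkSum_eq_sum_of_tail {d : V → ℝ} (hw : ∀ x ∈ S, ∀ y ∈ S, x ≠ y → β x y = d x)
    (he : ∀ x ∈ S, β x t = d x) {x : V} {X : List V} (hnd : (x :: X).Nodup)
    (hS : ∀ z ∈ x :: X, z ∈ S) : walkSum β x X t = ((x :: X).map d).sum := by
  induction X generalizing x with
  | nil => simp [he x (hS x (by simp))]
  | cons y X ih =>
    rw [walkSum_cons, ih (List.nodup_cons.1 hnd).2 fun z hz => hS z (List.mem_cons_of_mem _ hz),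
      hw x (hS x (by simp)) y (hS y (by simp)) (by rintro rfl; simp at hnd)]
    simp

variable [DecidableEq V]

theorem ConstThrough.inner_eq (h : ConstThrough β S o i t γ r) (hr : 2 ≤ r) (hrS : r ≤ S.card)
    (hi : ∀ x ∈ S, β i x = 0) (hoi : β o i = 0) {x y : V} (hx : x ∈ S) (hy : y ∈ S)
    (hxy : x ≠ y) : β x y = β o x + β x i := by
  obtain ⟨Z, hZ, hZl, hZS, hZE⟩ := exists_nodup_list S {x, y} (r - 2) (by
    rw [Finset.card_pair hxy]; omega)
  have hxZ : x ∉ Z := fun hz => hZE x hz (by simp)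
  have hyZ : y ∉ Z := fun hz => hZE y hz (by simp)
  have h0 := h [] (x :: y :: Z) (by simp [*]) (by simp [*]; exact hZS) (by simp; omega)
  have h1 := h [x] (y :: Z) (by simp [*]) (by simp [*]; exact hZS) (by simp; omega)
  simp only [walkSum_nil, walkSum_cons, hi x hx, hi y hy, hoi] at h0 h1
  linarith

theorem ConstThrough.last_eq (h : ConstThrough β S o i t γ r) (hr : 2 ≤ r) (hrS : r ≤ S.card)
    (hi : ∀ x ∈ S, β i x = 0) (hit : β i t = 0) (hoi : β o i = 0) {x y : V}
    (hx : x ∈ S) (hy : y ∈ S) (hxy : x ≠ y) : β y t = β o x + β y i := by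
  obtain ⟨Z, hZ, hZl, hZS, hZE⟩ := exists_nodup_list S {x, y} (r - 2) (by
    rw [Finset.card_pair hxy]; omega)
  have hxZ : x ∉ Z := fun hz => hZE x hz (by simp)
  have hyZ : y ∉ Z := fun hz => hZE y hz (by simp)
  have hnd : (x :: (Z ++ [y])).Nodup := by
    simp only [List.nodup_cons, List.nodup_append, List.mem_append, List.mem_singleton]
    refine ⟨by simp [*], hZ, by simp, ?_⟩
    rintro a ha b rfl rfl
    exact hyZ ha
  have hS : ∀ z ∈ x :: (Z ++ [y]), z ∈ S := by
    intro z hz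
    simp only [List.mem_cons, List.mem_append, List.not_mem_nil, or_false] at hz
    rcases hz with rfl | hz | rfl
    exacts [hx, hZS z hz, hy]
  have h0 := h [] (x :: (Z ++ [y])) (by simpa using hnd) (by simpa using hS) (by simp; omega)
  have h1 := h (x :: (Z ++ [y])) [] (by simpa using hnd) (by simpa using hS) (by simp; omega)
  simp only [walkSum_nil, walkSum_cons, walkSum_append_cons, hi x hx, hit, hoi] at h0 h1
  linarith

/-- For `2 ≤ r < |S|` the node weights are constant on `S`. -/
theorem ConstThrough.tail_const (h : ConstThrough β S o i t γ r) (hr : 2 ≤ r)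
    (hrS : r < S.card) (hi : ∀ x ∈ S, β i x = 0) (hoi : β o i = 0)
    {d : V → ℝ} (hw : ∀ x ∈ S, ∀ y ∈ S, x ≠ y → β x y = d x) (he : ∀ x ∈ S, β x t = d x)
    {x y : V} (hx : x ∈ S) (hy : y ∈ S) : d x = d y := by
  rcases eq_or_ne x y with rfl | hxy
  · rfl
  obtain ⟨Z, hZ, hZl, hZS, hZE⟩ := exists_nodup_list S {x, y} (r - 1) (by
    rw [Finset.card_pair hxy]; omega)
  have hxZ : x ∉ Z := fun hz => hZE x hz (by simp)
  have hyZ : y ∉ Z := fun hz => hZE y hz (by simp)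
  have key : ∀ v ∈ S, v ∉ Z → d v + (Z.map d).sum = γ := by
    intro v hv hvZ
    have hnd : (v :: Z).Nodup := List.nodup_cons.2 ⟨hvZ, hZ⟩
    have hS : ∀ z ∈ v :: Z, z ∈ S := by
      intro z hz
      rcases List.mem_cons.1 hz with rfl | hz
      exacts [hv, hZS z hz]
    have h0 := h [] (v :: Z) hnd hS (by simp; omega)
    rw [walkSum_nil, walkSum_cons, hoi, hi v hv, walkSum_eq_sum_of_tail hw he hnd hS] at h0
    simpa using h0
  linarith [key x hx hxZ, key y hy hyZ]

theorem ConstThrough.eq_mul (h : ConstThrough β S o i t γ r) (hrS : r ≤ S.card)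
    (hi : ∀ x ∈ S, β i x = 0) (hit : β i t = 0) (hoi : β o i = 0) {δ : ℝ}
    (hw : ∀ x ∈ S, ∀ y ∈ S, x ≠ y → β x y = δ) (he : ∀ x ∈ S, β x t = δ) :
    γ = r * δ := by
  obtain ⟨Z, hZ, hZl, hZS, -⟩ := exists_nodup_list S ∅ r (by simpa)
  have h0 := h [] Z hZ hZS (by simpa using hZl)
  cases Z with
  | nil =>
    simp only [walkSum_nil, hoi, hit] at h0
    simp [← h0, ← hZl]
  | cons x Z =>
    rw [walkSum_nil, walkSum_cons, hoi, hi x (hZS x (by simp)),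
      walkSum_eq_sum_of_tail (d := fun _ => δ) hw he hZ hZS] at h0
    rw [← h0, ← hZl]
    simp
    ring

/-- A normalized weight that is constant on the walks through `i` of two suitable lengths is
constant on all walks from `o` to `t` inside `S`. -/
theorem walkSum_const_of_constThrough (h : ConstThrough β S o i t γ r)
    (h' : ConstThrough β S o i t γ r') (hrr : r < r') (hr' : 2 ≤ r') (hrS : r' ≤ S.card)
    (hpair : 1 ≤ r ∨ r' < S.card)
    (hi : ∀ x ∈ S, β i x = 0) (hit : β i t = 0) (hoi : β o i = 0) :
    ∃ σ : ℝ, ∀ X : List V, X ≠ [] → X.Nodup → (∀ x ∈ X, x ∈ S) → walkSum β o X t = σ := by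
  have hin : ∀ x ∈ S, ∀ y ∈ S, x ≠ y → β x y = β o x + β x i :=
    fun x hx y hy => h'.inner_eq hr' hrS hi hoi hx hy
  have hla : ∀ x ∈ S, ∀ y ∈ S, x ≠ y → β y t = β o x + β y i :=
    fun x hx y hy => h'.last_eq hr' hrS hi hit hoi hx hy
  have hex : ∀ x ∈ S, ∃ y ∈ S, y ≠ x := fun x _ =>
    Finset.exists_mem_ne (by omega) x
  have he : ∀ x ∈ S, β x t = β o x + β x i := by
    intro x hx
    rcases eq_or_ne r 1 with rfl | hr1
    · have h0 := h [] [x] (by simp) (by simpa) (by simp)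
      have h1 := h [x] [] (by simp) (by simpa) (by simp)
      simp only [walkSum_nil, walkSum_cons, hi x hx, hit, hoi] at h0 h1
      linarith
    · obtain ⟨y, hy, hyx⟩ := hex x hx
      obtain ⟨z, hz, hzE⟩ := Finset.exists_mem_notMem_of_card_lt_card
        (s := {x, y}) (t := S) (by rw [Finset.card_pair hyx.symm]; omega)
      simp only [Finset.mem_insert, Finset.mem_singleton, not_or] at hzE
      have e1 := hla y hy x hx hyx
      have e2 := hla y hy z hz (Ne.symm hzE.2)
      have e3 := hla x hx z hz (Ne.symm hzE.1)
      linarith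
  have hd : ∀ x ∈ S, ∀ y ∈ S, β o x + β x i = β o y + β y i := by
    intro x hx y hy
    rcases eq_or_ne r 1 with rfl | hr1
    · have h0 := h [x] [] (by simp) (by simpa) (by simp)
      have h1 := h [y] [] (by simp) (by simpa) (by simp)
      simp only [walkSum_nil, walkSum_cons, hit] at h0 h1
      linarith
    · by_cases hr : 1 ≤ r
      · exact h.tail_const (by omega) (by omega) hi hoi hin he hx hy
      · exact h'.tail_const hr' (by omega) hi hoi hin he hx hy
  obtain ⟨x₀, hx₀⟩ : S.Nonempty := Finset.card_pos.1 (by omega)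
  have hδ : β o x₀ + β x₀ i = 0 := by
    have hw : ∀ x ∈ S, ∀ y ∈ S, x ≠ y → β x y = β o x₀ + β x₀ i :=
      fun x hx y hy hxy => (hin x hx y hy hxy).trans (hd x hx x₀ hx₀)
    have he' : ∀ x ∈ S, β x t = β o x₀ + β x₀ i :=
      fun x hx => (he x hx).trans (hd x hx x₀ hx₀)
    have e1 := h.eq_mul (by omega) hi hit hoi hw he'
    have e2 := h'.eq_mul hrS hi hit hoi hw he'
    have e3 : ((r' : ℝ) - r) * (β o x₀ + β x₀ i) = 0 := by linarith
    have e4 : (r : ℝ) < r' := by exact_mod_cast hrr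
    exact (mul_eq_zero.1 e3).resolve_left (by linarith)
  have hd0 : ∀ x ∈ S, β o x + β x i = 0 := fun x hx => (hd x hx x₀ hx₀).trans hδ
  refine ⟨β o x₀, fun X hX hnd hS => ?_⟩
  cases X with
  | nil => exact absurd rfl hX
  | cons x X =>
    have hx := hS x (by simp)
    have hz : walkSum β x X t = 0 := by
      rw [walkSum_eq_sum_of_tail (d := fun _ => 0)
        (fun x hx y hy hxy => (hin x hx y hy hxy).trans (hd0 x hx))
        (fun x hx => (he x hx).trans (hd0 x hx)) hnd hS]
      simp
    rw [walkSum_cons, hz, add_zero]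
    rcases eq_or_ne x x₀ with rfl | hne
    · rfl
    · have e1 := hla x hx x₀ hx₀ hne
      have e2 := he x₀ hx₀
      linarith

/-- The same conclusion for weights that are not normalized. -/
theorem walkSum_const_of_constThrough' {α : V → V → ℝ} (h : ConstThrough α S o i t γ r)
    (h' : ConstThrough α S o i t γ r') (hrr : r < r') (hr' : 2 ≤ r') (hrS : r' ≤ S.card)
    (hpair : 1 ≤ r ∨ r' < S.card) (hiS : i ∉ S) (hoS : o ∉ S) (hio : i ≠ o) (hit : i ≠ t)
    (hot : o ≠ t) :
    ∃ σ : ℝ, ∀ X : List V, X ≠ [] → X.Nodup → (∀ x ∈ X, x ∈ S) → walkSum α o X t = σ := by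
  let π : V → ℝ := fun x => if x = i then 0 else if x = o then -α o i else α i x
  have hπi : π i = 0 := by simp [π]
  have hπo : π o = -α o i := by simp [π, hio.symm]
  have hπt : π t = α i t := by simp [π, hit.symm, hot.symm]
  have hπS : ∀ x ∈ S, π x = α i x := by
    intro x hx
    have h1 : x ≠ i := fun h => hiS (h ▸ hx)
    have h2 : x ≠ o := fun h => hoS (h ▸ hx)
    simp [π, h1, h2]
  have shift : ∀ {r : ℕ}, ConstThrough α S o i t γ r →
      ConstThrough (fun a b => α a b - (π b - π a)) S o i t (γ - (π t - π o)) r := by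
    intro r h A B h1 h2 h3
    rw [walkSum_sub_potential, walkSum_sub_potential, ← h A B h1 h2 h3]
    ring
  obtain ⟨σ, hσ⟩ := walkSum_const_of_constThrough (shift h) (shift h') hrr hr' hrS hpair
    (fun x hx => by simp [hπi, hπS x hx]) (by simp [hπi, hπt]) (by simp [hπi, hπo])
  refine ⟨σ + (π t - π o), fun X h1 h2 h3 => ?_⟩
  have := hσ X h1 h2 h3
  rw [walkSum_sub_potential] at this
  linarith

end Normalized

end Walks

/-- A valid inequality for the hull of `s` defines a facet if it is tight at some but not all
points of `s`, and every linear functional that is constant on the tight points of `s` is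
constant on the other points of `s`. -/
theorem isFacetLE_convexHull {E : Type*} [AddCommGroup E] [Module ℝ E] [FiniteDimensional ℝ E]
    {s : Set E} {f : E →ₗ[ℝ] ℝ} {b : ℝ} (hle : ∀ v ∈ s, f v ≤ b) {v₀ v₁ : E} (h₀ : v₀ ∈ s)
    (h₁ : v₁ ∈ s) (hf₀ : f v₀ ≠ b) (hf₁ : f v₁ = b)
    (H : ∀ (g : E →ₗ[ℝ] ℝ) (γ : ℝ), (∀ v ∈ s, f v = b → g v = γ) →
      ∃ σ : ℝ, ∀ v ∈ s, f v ≠ b → g v = σ) :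
    IsFacetLE (convexHull ℝ s) f b := by
  refine ⟨fun x hx => ?_, ?_⟩
  · exact convexHull_min (t := {x | f x ≤ b}) hle (convex_halfSpace_le f.isLinear b) hx
  set F : Set E := {x ∈ convexHull ℝ s | f x = b}
  have hsF : ∀ v ∈ s, f v = b → v ∈ F := fun v hv hb => ⟨subset_convexHull ℝ s hv, hb⟩
  have hker : vectorSpan ℝ F ≤ LinearMap.ker f := by
    rw [vectorSpan_def, Submodule.span_le]
    rintro _ ⟨x, hx, y, hy, rfl⟩
    simp [hx.2, hy.2]
  have hnot : v₀ - v₁ ∉ vectorSpan ℝ F := by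
    intro h
    have := hker h
    rw [LinearMap.mem_ker, map_sub, hf₁] at this
    exact hf₀ (by linarith)
  have hs : vectorSpan ℝ (convexHull ℝ s) = vectorSpan ℝ s := by
    rw [← direction_affineSpan, affineSpan_convexHull, direction_affineSpan]
  have hout : ∀ v ∈ s, f v ≠ b → v - v₀ ∈ vectorSpan ℝ F := by
    intro v hv hvb
    by_contra hmem
    obtain ⟨g, hg, hgF⟩ := Submodule.exists_le_ker_of_notMem hmem
    obtain ⟨σ, hσ⟩ := H g (g v₁) fun u hu hub => by
      have := hgF (vsub_mem_vectorSpan ℝ (hsF u hu hub) (hsF v₁ h₁ hf₁))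
      rw [LinearMap.mem_ker, vsub_eq_sub, map_sub] at this
      linarith
    apply hg
    rw [map_sub, hσ v hv hvb, hσ v₀ h₀ hf₀, sub_self]
  have key : vectorSpan ℝ (convexHull ℝ s) =
      vectorSpan ℝ F ⊔ Submodule.span ℝ {v₀ - v₁} := by
    apply le_antisymm
    · rw [hs, vectorSpan_eq_span_vsub_set_right ℝ h₁, Submodule.span_le]
      rintro _ ⟨v, hv, rfl⟩
      by_cases hvb : f v = b
      · exact Submodule.mem_sup_left (vsub_mem_vectorSpan ℝ (hsF v hv hvb) (hsF v₁ h₁ hf₁))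
      · have e : v -ᵥ v₁ = (v - v₀) + (v₀ - v₁) := by simp
        change v -ᵥ v₁ ∈ _
        rw [e]
        exact Submodule.add_mem_sup (hout v hv hvb) (Submodule.mem_span_singleton_self _)
    · refine sup_le (vectorSpan_mono ℝ fun x hx => hx.1) ?_
      rw [Submodule.span_singleton_le_iff_mem]
      exact vsub_mem_vectorSpan ℝ (subset_convexHull ℝ s h₀) (subset_convexHull ℝ s h₁)
  change Module.finrank ℝ (vectorSpan ℝ F) + 1 = Module.finrank ℝ (vectorSpan ℝ (convexHull ℝ s))
  rw [key, Submodule.finrank_sup_span_singleton hnot]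

/-- The internal nodes other than `i`. -/
def otherNodes (n : ℕ) (i : Fin (n + 1)) : Finset (Fin (n + 1)) :=
  Finset.univ \ {0, i, Fin.last n}

theorem mem_otherNodes {n : ℕ} {i x : Fin (n + 1)} :
    x ∈ otherNodes n i ↔ x ≠ 0 ∧ x ≠ i ∧ x ≠ Fin.last n := by
  simp [otherNodes]

theorem card_otherNodes {n : ℕ} {i : Fin (n + 1)} (hi0 : i ≠ 0) (hin : i ≠ Fin.last n) :
    (otherNodes n i).card = n - 2 := by
  have h0n : (0 : Fin (n + 1)) ≠ Fin.last n := by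
    rintro h
    have h1 := congrArg Fin.val h
    simp only [Fin.val_zero, Fin.val_last] at h1
    exact hin (Fin.ext (by rw [Fin.val_last]; omega))
  rw [otherNodes, Finset.card_sdiff_of_subset (Finset.subset_univ _), Finset.card_fin,
    Finset.card_eq_three.2 ⟨0, i, Fin.last n, hi0.symm, h0n, hin, rfl⟩]
  omega

/-- A list of distinct internal nodes. -/
def IsInternal (n : ℕ) (X : List (Fin (n + 1))) : Prop :=
  X.Nodup ∧ ∀ x ∈ X, x ≠ 0 ∧ x ≠ Fin.last n

/-- The arc set of the walk from `0` to `n` that visits the nodes of the list. -/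
def pathArcs (n : ℕ) (X : List (Fin (n + 1))) : Finset (Fin (n + 1) × Fin (n + 1)) :=
  (walkArcs 0 X (Fin.last n)).toFinset

theorem IsInternal.nodup_cons {n : ℕ} {X : List (Fin (n + 1))} (hX : IsInternal n X) :
    ((0 : Fin (n + 1)) :: X).Nodup :=
  List.nodup_cons.2 ⟨fun h => (hX.2 _ h).1 rfl, hX.1⟩

theorem IsInternal.card_pathArcs {n : ℕ} {X : List (Fin (n + 1))} (hX : IsInternal n X) :
    (pathArcs n X).card = X.length + 1 := by
  rw [pathArcs, List.toFinset_card_of_nodup (nodup_walkArcs hX.nodup_cons), length_walkArcs]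

theorem IsInternal.sum_pathArcs {n : ℕ} {X : List (Fin (n + 1))} (hX : IsInternal n X)
    (α : Fin (n + 1) → Fin (n + 1) → ℝ) :
    ∑ a ∈ pathArcs n X, α a.1 a.2 = walkSum α 0 X (Fin.last n) :=
  List.sum_toFinset _ (nodup_walkArcs hX.nodup_cons)

theorem pathArcs_ofFn {n k : ℕ} {f : Fin (k + 2) → Fin (n + 1)} (h0 : f 0 = 0)
    (hk : f (Fin.last (k + 1)) = Fin.last n) :
    pathArcs n (List.ofFn fun j : Fin k => f j.succ.castSucc) =
      Finset.image (fun j : Fin (k + 1) => (f j.castSucc, f j.succ)) Finset.univ := by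
  ext a
  rw [pathArcs, ← hk, ← h0, walkArcs_ofFn, List.mem_toFinset, List.mem_ofFn]
  simp only [Finset.mem_image, Finset.mem_univ, true_and]

theorem IsTildePath.exists_pathArcs {n : ℕ} {P : Finset (Fin (n + 1) × Fin (n + 1))}
    (hn : n ≠ 0) (hP : IsTildePath n P) : ∃ X, IsInternal n X ∧ P = pathArcs n X := by
  obtain ⟨-, k, f, hf, h0, hk, rfl⟩ := hP
  cases k with
  | zero =>
    have h := h0.symm.trans hk
    exact absurd (congrArg Fin.val h).symm (by simpa using hn)
  | succ k =>
    refine ⟨_, ⟨?_, ?_⟩, (pathArcs_ofFn h0 hk).symm⟩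
    · rw [List.nodup_ofFn]
      exact hf.comp ((Fin.castSucc_injective _).comp (Fin.succ_injective _))
    · intro x hx
      obtain ⟨j, rfl⟩ := List.mem_ofFn.1 hx
      rw [← h0, ← hk]
      refine ⟨fun h => ?_, fun h => ?_⟩
      · have := congrArg Fin.val (hf h)
        simp at this
      · have := congrArg Fin.val (hf h)
        simp at this
        omega

theorem IsInternal.pathArcs_subset {n : ℕ} {X : List (Fin (n + 1))} (hn : n ≠ 0)
    (hX : IsInternal n X) (hne : X ≠ []) : pathArcs n X ⊆ tA n := by
  intro a ha
  have ha := List.mem_toFinset.1 ha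
  have h0n : (0 : Fin (n + 1)) ≠ Fin.last n := fun h => hn (congrArg Fin.val h).symm
  have hnd : ((0 : Fin (n + 1)) :: (X ++ [Fin.last n])).Nodup := by
    have hl : Fin.last n ∉ X := fun h => (hX.2 _ h).2 rfl
    have hz : (0 : Fin (n + 1)) ∉ X := fun h => (hX.2 _ h).1 rfl
    simp only [List.nodup_cons, List.nodup_append, List.mem_append, List.mem_singleton]
    refine ⟨by simp [hz, h0n], hX.1, by simp, ?_⟩
    rintro a ha b rfl rfl
    exact hl ha
  have h1 : a.1 ∈ (0 : Fin (n + 1)) :: X := by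
    rw [← map_fst_walkArcs 0 (Fin.last n) X]
    exact List.mem_map_of_mem ha
  have h2 : a.2 ∈ X ++ [Fin.last n] := by
    rw [← map_snd_walkArcs 0 (Fin.last n) X]
    exact List.mem_map_of_mem ha
  simp only [tA, Finset.mem_filter, Finset.mem_univ, true_and]
  refine ⟨ne_of_mem_walkArcs hnd ha, ?_, ?_, ?_⟩
  · intro h
    rw [h] at h2
    exact (List.nodup_cons.1 hnd).1 h2
  · intro h
    rcases List.mem_cons.1 h1 with h1 | h1
    exacts [h0n (h1.symm.trans h), (hX.2 _ h1).2 h]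
  · rintro ⟨e1, e2⟩
    cases X with
    | nil => exact hne rfl
    | cons x X =>
      rcases List.mem_cons.1 ha with rfl | ha
      · exact (hX.2 x (by simp)).2 e2
      · have : a.1 ∈ x :: X := by
          rw [← map_fst_walkArcs x (Fin.last n) X]
          exact List.mem_map_of_mem ha
        exact (hX.2 _ this).1 e1

theorem IsInternal.isTildePath {n : ℕ} {X : List (Fin (n + 1))} (hn : n ≠ 0)
    (hX : IsInternal n X) (hne : X ≠ []) : IsTildePath n (pathArcs n X) := by
  refine ⟨hX.pathArcs_subset hn hne, X.length + 1,
    Fin.cons 0 (Fin.snoc (α := fun _ => Fin (n + 1)) X.get (Fin.last n)), ?_, by simp, ?_, ?_⟩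
  · rw [Fin.cons_injective_iff, Fin.snoc_injective_iff]
    refine ⟨?_, List.nodup_iff_injective_get.1 hX.1, ?_⟩
    · rintro ⟨j, hj⟩
      induction j using Fin.lastCases with
      | last =>
        rw [Fin.snoc_last] at hj
        exact hn (congrArg Fin.val hj)
      | cast j =>
        rw [Fin.snoc_castSucc] at hj
        exact (hX.2 _ (List.get_mem X j)).1 hj
    · rintro ⟨j, hj⟩
      exact (hX.2 _ (List.get_mem X j)).2 hj
  · rw [← Fin.succ_last, Fin.cons_succ, Fin.snoc_last]
  · rw [← pathArcs_ofFn (by simp) (by rw [← Fin.succ_last, Fin.cons_succ, Fin.snoc_last])]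
    congr 1
    simp [Fin.snoc_castSucc]

theorem linearMap_incVec {n : ℕ} (g : (Fin (n + 1) → Fin (n + 1) → ℝ) →ₗ[ℝ] ℝ)
    (P : Finset (Fin (n + 1) × Fin (n + 1))) :
    g (incVec P) = ∑ a ∈ P, g (Pi.single a.1 (Pi.single a.2 1)) := by
  rw [← map_sum]
  congr 1
  ext u v
  have : ∀ a : Fin (n + 1) × Fin (n + 1),
      (Pi.single a.1 (Pi.single a.2 1) : Fin (n + 1) → Fin (n + 1) → ℝ) u v =
        if (u, v) = a then 1 else 0 := by
    rintro ⟨a, b⟩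
    by_cases h1 : u = a
    · subst h1
      by_cases h2 : v = b <;> simp [h2]
    · simp [h1]
  simp [incVec, Finset.sum_apply, this]

theorem IsInternal.outT_incVec {n : ℕ} {X : List (Fin (n + 1))} (hn : n ≠ 0)
    (hX : IsInternal n X) (hne : X ≠ []) {i : Fin (n + 1)} (hi0 : i ≠ 0) :
    outT n (incVec (pathArcs n X)) i = if i ∈ X then 1 else 0 := by
  have h := hX.sum_pathArcs fun a _ => if a = i then (1 : ℝ) else 0
  rw [walkSum_indicator_tail, List.count_cons_of_ne hi0.symm, hX.1.count] at h
  have e : outT n (incVec (pathArcs n X)) i =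
      ∑ a ∈ pathArcs n X, if a.1 = i then (1 : ℝ) else 0 := by
    simp only [outT, incVec]
    rw [← Finset.sum_filter, ← Finset.sum_filter, Finset.filter_filter]
    refine Finset.sum_congr ?_ fun _ _ => rfl
    ext a
    simp only [Finset.mem_filter]
    exact ⟨fun h => ⟨h.2.2, h.2.1⟩, fun h => ⟨hX.pathArcs_subset hn hne h.1, h.2, h.1⟩⟩
  rw [e, h]
  split_ifs <;> simp

/-- Up to the two exceptional cases a cardinality sequence contains two lengths to which the
exchange argument applies. -/
theorem exists_good_lengths {n m : ℕ} (hm : 2 ≤ m) {c : Fin m → ℕ} (hmono : StrictMono c)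
    (hc2 : ∀ p, 2 ≤ c p) (hcn : ∀ p, c p ≤ n) (hCS : Set.range c ≠ {2, 3})
    (h2n : Set.range c ≠ {2, n}) :
    ∃ p q, c p < c q ∧ 4 ≤ c q ∧ (3 ≤ c p ∨ c q < n) := by
  have h01 : c ⟨0, by omega⟩ < c ⟨1, hm⟩ := hmono (by simp)
  have h0 := hc2 ⟨0, by omega⟩
  by_cases h : 3 ≤ c ⟨0, by omega⟩
  · exact ⟨_, _, h01, by omega, Or.inl h⟩
  by_cases h3 : 2 < m
  · have h12 : c ⟨1, hm⟩ < c ⟨2, h3⟩ := hmono (by simp)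
    exact ⟨_, _, h12, by omega, Or.inl (by omega)⟩
  obtain rfl : m = 2 := by omega
  have h0' : c 0 = 2 := le_antisymm (by simpa using Nat.le_of_not_lt h) h0
  have hr : Set.range c = {2, c 1} := by
    ext x
    simp [Fin.exists_fin_two, h0', eq_comm]
  have h13 : c 1 ≠ 3 := fun e => hCS (by rw [hr, e])
  have h1n : c 1 ≠ n := fun e => h2n (by rw [hr, e])
  have h1 := hcn 1
  have h01' : c 0 < c 1 := h01
  exact ⟨0, 1, h01', by omega, Or.inr (by omega)⟩

/-- **Theorem 9 (degree constraint facets).**  Let `n ≥ 4` and let `c` be a cardinality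
sequence in `CS` (`m ≥ 2`, `2 ≤ c 0 < ⋯ < c (m-1) ≤ n`, `c ≠ (2,3)`) with `c ≠ (2,n)`,
and let `i` be an internal node of `D̃_n`.  Then the degree constraint
`x(δ^out(i)) ≤ 1` defines a facet of `P_{0,n-path}^c(D̃_n)`. -/
theorem degree_facet_pathPolytope (n m : ℕ) (hn : 4 ≤ n) (hm : 2 ≤ m)
    (c : Fin m → ℕ) (hmono : StrictMono c)
    (hc2 : ∀ p, 2 ≤ c p) (hcn : ∀ p, c p ≤ n)
    (hCS : Set.range c ≠ {2, 3}) (h2n : Set.range c ≠ {2, n})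
    (i : Fin (n + 1)) (hi0 : i ≠ 0) (hin : i ≠ Fin.last n) :
    IsFacetLE (pathPolytope n c) (fun x => outT n x i) 1 := by
  have hn0 : n ≠ 0 := by omega
  have h0n : (0 : Fin (n + 1)) ≠ Fin.last n := fun h => hn0 (congrArg Fin.val h).symm
  have hS := card_otherNodes hi0 hin
  let f : (Fin (n + 1) → Fin (n + 1) → ℝ) →ₗ[ℝ] ℝ := IsLinearMap.mk' (fun x => outT n x i)
    ⟨fun x y => by simp [outT, Finset.sum_add_distrib], fun a x => by simp [outT, Finset.mul_sum]⟩
  have hfX : ∀ X, IsInternal n X → X ≠ [] → f (incVec (pathArcs n X)) = if i ∈ X then 1 else 0 :=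
    fun X hX hne => hX.outT_incVec hn0 hne hi0
  set s : Set (Fin (n + 1) → Fin (n + 1) → ℝ) :=
    {x | ∃ P, IsTildePath n P ∧ (∃ p, P.card = c p) ∧ x = incVec P}
  have hmem : ∀ X p, IsInternal n X → X.length + 1 = c p → X ≠ [] ∧ incVec (pathArcs n X) ∈ s := by
    intro X p hX hp
    have hne : X ≠ [] := by
      rintro rfl
      have := hc2 p
      simp only [List.length_nil] at hp
      omega
    exact ⟨hne, _, hX.isTildePath hn0 hne, ⟨p, hX.card_pathArcs.trans hp⟩, rfl⟩
  have hrep : ∀ v ∈ s, ∃ X, IsInternal n X ∧ X ≠ [] ∧ v = incVec (pathArcs n X) := by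
    rintro _ ⟨P, hP, ⟨p, hp⟩, rfl⟩
    obtain ⟨X, hX, rfl⟩ := hP.exists_pathArcs hn0
    rw [hX.card_pathArcs] at hp
    exact ⟨X, hX, (hmem X p hX hp).1, rfl⟩
  have h01 : c ⟨0, by omega⟩ < c ⟨1, hm⟩ := hmono (by simp)
  have h0 := hc2 ⟨0, by omega⟩
  have h1 := hcn ⟨1, hm⟩
  obtain ⟨Z, hZ, hZl, hZS, -⟩ := exists_nodup_list (otherNodes n i) ∅ (c ⟨0, by omega⟩ - 1)
    (by rw [Finset.card_empty]; omega)
  obtain ⟨Y, hY, hYl, hYS, -⟩ := exists_nodup_list (otherNodes n i) ∅ (c ⟨0, by omega⟩ - 2)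
    (by rw [Finset.card_empty]; omega)
  have hiZ : i ∉ Z := fun h => (mem_otherNodes.1 (hZS i h)).2.1 rfl
  have hiY : i ∉ Y := fun h => (mem_otherNodes.1 (hYS i h)).2.1 rfl
  have hZI : IsInternal n Z :=
    ⟨hZ, fun x hx => ⟨(mem_otherNodes.1 (hZS x hx)).1, (mem_otherNodes.1 (hZS x hx)).2.2⟩⟩
  have hYI : IsInternal n (i :: Y) := by
    refine ⟨List.nodup_cons.2 ⟨hiY, hY⟩, fun x hx => ?_⟩
    rcases List.mem_cons.1 hx with rfl | hx
    exacts [⟨hi0, hin⟩, ⟨(mem_otherNodes.1 (hYS x hx)).1, (mem_otherNodes.1 (hYS x hx)).2.2⟩]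
  have hZm := hmem Z ⟨0, by omega⟩ hZI (by omega)
  have hYm := hmem (i :: Y) ⟨0, by omega⟩ hYI (by rw [List.length_cons]; omega)
  refine isFacetLE_convexHull (f := f) ?_ hZm.2 hYm.2 ?_ ?_ ?_
  · intro v hv
    obtain ⟨X, hX, hne, rfl⟩ := hrep v hv
    rw [hfX X hX hne]
    split_ifs <;> norm_num
  · rw [hfX Z hZI hZm.1, if_neg hiZ]
    norm_num
  · rw [hfX _ hYI hYm.1, if_pos (by simp)]
  intro g γ hg
  have hgX : ∀ X, IsInternal n X → g (incVec (pathArcs n X)) =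
      walkSum (fun a b => g (Pi.single a (Pi.single b 1))) 0 X (Fin.last n) := by
    intro X hX
    rw [linearMap_incVec]
    exact hX.sum_pathArcs fun a b => g (Pi.single a (Pi.single b 1))
  have hconst : ∀ p, ConstThrough (fun a b => g (Pi.single a (Pi.single b 1)))
      (otherNodes n i) 0 i (Fin.last n) γ (c p - 2) := by
    intro p A B hAB hABS hl
    have hp := hc2 p
    have hX : IsInternal n (A ++ i :: B) := by
      constructor
      · rw [List.nodup_middle, List.nodup_cons]
        exact ⟨fun h => (mem_otherNodes.1 (hABS i h)).2.1 rfl, hAB⟩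
      · intro x hx
        rcases List.mem_cons.1 (List.perm_middle.mem_iff.1 hx) with rfl | hx
        · exact ⟨hi0, hin⟩
        · have := mem_otherNodes.1 (hABS x hx)
          exact ⟨this.1, this.2.2⟩
    obtain ⟨hne, hXs⟩ := hmem _ p hX (by rw [List.length_append, List.length_cons]; omega)
    rw [← walkSum_append_cons, ← hgX _ hX]
    exact hg _ hXs (by rw [hfX _ hX hne, if_pos (by simp)])
  obtain ⟨p, q, hpq, hq, hor⟩ := exists_good_lengths hm hmono hc2 hcn hCS h2n
  have hp2 := hc2 p
  have hqn := hcn q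
  obtain ⟨σ, hσ⟩ := walkSum_const_of_constThrough' (hconst p) (hconst q) (by omega) (by omega)
    (by omega) (by omega) (fun h => (mem_otherNodes.1 h).2.1 rfl)
    (fun h => (mem_otherNodes.1 h).1 rfl) hi0 hin h0n
  refine ⟨σ, fun v hv hvb => ?_⟩
  obtain ⟨X, hX, hne, rfl⟩ := hrep v hv
  rw [hfX X hX hne] at hvb
  have hiX : i ∉ X := fun h => hvb (if_pos h)
  rw [hgX X hX]
  exact hσ X hne hX.1 fun x hx =>
    mem_otherNodes.2 ⟨(hX.2 x hx).1, fun h => hiX (h ▸ hx), (hX.2 x hx).2⟩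
end

section
/- Let n ≥ 4, let c = (c_1,…,c_m) be a cardinality sequence in CS (i.e. m ≥ 2, 2 ≤ c_1 < ⋯ < c_m ≤ n, and c ≠ (2,3)), and let S ⊂ Ñ_n with 0, n ∈ S. Then the min-cut inequality x((S : Ñ_n∖S)) ≥ 1 is valid for P_{0,n-path}^c(D̃_n) if and only if |S| ≤ c_1, and it defines a facet of P_{0,n-path}^c(D̃_n) if and only if 3 ≤ |S| ≤ c_1 and |Ñ_n ∖ S| ≥ 2. -/
open Finset

section Facet

variable {V : Type*} [AddCommGroup V] [Module ℝ V]

theorem vectorSpan_convexHull (X : Set V) :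
    vectorSpan ℝ (convexHull ℝ X) = vectorSpan ℝ X := by
  rw [← direction_affineSpan, ← direction_affineSpan, affineSpan_convexHull]

theorem vectorSpan_le_ker_iff {X : Set V} {x₁ : V} (hx₁ : x₁ ∈ X) (φ : V →ₗ[ℝ] ℝ) :
    vectorSpan ℝ X ≤ LinearMap.ker φ ↔ ∀ x ∈ X, φ x = φ x₁ := by
  rw [vectorSpan_eq_span_vsub_set_right ℝ hx₁, Submodule.span_le, Set.image_subset_iff]
  refine forall₂_congr fun x _ => ?_
  simp [sub_eq_zero]

theorem adim_face_add_one [FiniteDimensional ℝ V] {X : Set V} {ℓ : V →ₗ[ℝ] ℝ} {b : ℝ} {x₀ x₁ : V}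
    (hx₀ : x₀ ∈ X) (hx₁ : x₁ ∈ X) (h₀ : ℓ x₀ ≠ b) (h₁ : ℓ x₁ = b)
    (H : ∀ (φ : V →ₗ[ℝ] ℝ) (β : ℝ), (∀ x ∈ X, ℓ x = b → φ x = β) →
      ∃ s t : ℝ, ∀ x ∈ X, φ x = s * ℓ x + t) :
    adim {x ∈ convexHull ℝ X | ℓ x = b} + 1 = adim (convexHull ℝ X) := by
  set F := {x ∈ convexHull ℝ X | ℓ x = b} with hF
  have hx₁F : x₁ ∈ F := ⟨subset_convexHull ℝ X hx₁, h₁⟩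
  have hFℓ : vectorSpan ℝ F ≤ LinearMap.ker ℓ :=
    (vectorSpan_le_ker_iff hx₁F ℓ).2 fun x hx => hx.2.trans h₁.symm
  have hv : x₀ - x₁ ∉ vectorSpan ℝ F := fun h => by
    have := hFℓ h
    rw [LinearMap.mem_ker, map_sub, h₁, sub_eq_zero] at this
    exact h₀ this
  have hFX : vectorSpan ℝ F ≤ vectorSpan ℝ X := by
    rw [← vectorSpan_convexHull X]
    exact vectorSpan_mono ℝ fun x hx => hx.1
  have hsup : vectorSpan ℝ F ⊔ Submodule.span ℝ {x₀ - x₁} = vectorSpan ℝ X := by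
    refine le_antisymm (sup_le hFX ?_) ?_
    · rw [Submodule.span_singleton_le_iff_mem]
      exact vsub_mem_vectorSpan ℝ hx₀ hx₁
    · rw [← Subspace.dualAnnihilator_le_dualAnnihilator_iff]
      intro φ hφ
      rw [Submodule.mem_dualAnnihilator] at hφ ⊢
      change vectorSpan ℝ X ≤ LinearMap.ker φ
      rw [vectorSpan_le_ker_iff hx₁]
      have hφF : ∀ x ∈ F, φ x = φ x₁ := (vectorSpan_le_ker_iff hx₁F φ).1
        fun w hw => hφ w (Submodule.mem_sup_left hw)
      have hφv : φ x₀ = φ x₁ := by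
        have := hφ (x₀ - x₁) (Submodule.mem_sup_right (Submodule.mem_span_singleton_self _))
        rwa [map_sub, sub_eq_zero] at this
      obtain ⟨s, t, hst⟩ := H φ (φ x₁) fun x hx hxb => hφF x ⟨subset_convexHull ℝ X hx, hxb⟩
      have h : s * (ℓ x₀ - b) = 0 := by
        rw [← h₁]
        linarith [hst x₀ hx₀, hst x₁ hx₁]
      have hs : s = 0 := (mul_eq_zero.1 h).resolve_right (sub_ne_zero.2 h₀)
      intro x hx
      rw [hst x hx, hst x₁ hx₁, hs]
      ring
  have hv0 : x₀ - x₁ ≠ 0 := fun h => hv (by rw [h]; exact zero_mem _)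
  have := Submodule.finrank_sup_add_finrank_inf_eq (vectorSpan ℝ F) (Submodule.span ℝ {x₀ - x₁})
  rw [hsup, (Submodule.disjoint_span_singleton_of_notMem hv).eq_bot, finrank_bot,
    finrank_span_singleton hv0] at this
  rw [adim, adim, vectorSpan_convexHull]
  exact this.symm

end Facet

/-- The total weight of the walk that starts in `p`, traverses the list, and ends in `e`. -/
def walkWeight {α : Type*} (y : α → α → ℝ) (e : α) : α → List α → ℝ
  | p, [] => y p e
  | p, v :: l => y p v + walkWeight y e v l

/-- A common initial part of two walks can be cancelled. -/
theorem walkWeight_append_cons_inj {α : Type*} (y : α → α → ℝ) (e p q : α) (l r r' : List α) :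
    walkWeight y e p (l ++ q :: r) = walkWeight y e p (l ++ q :: r') ↔
      walkWeight y e q r = walkWeight y e q r' := by
  induction l generalizing p with
  | nil => simp [walkWeight]
  | cons v l ih => simp [walkWeight, ih]

theorem walkWeight_concat_of_isChain {α : Type*} (y : α → α → ℝ) (e u : α) (κ : ℝ) (p : α)
    (l : List α) (h : (p :: (l ++ [u])).IsChain (fun i j => y i j = κ)) :
    walkWeight y e p (l ++ [u]) = κ * (l.length + 1) + y u e := by
  induction l generalizing p with
  | nil => simp_all [walkWeight]
  | cons v l ih =>
    rw [List.cons_append, List.isChain_cons_cons] at h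
    simp only [List.cons_append, walkWeight, ih v h.2, h.1, List.length_cons]
    push_cast
    ring

theorem walkWeight_add_sub {α : Type*} (y : α → α → ℝ) (ρ : α → ℝ) (e p : α) (l : List α) :
    walkWeight (fun i j => y i j + ρ i - ρ j) e p l = walkWeight y e p l + ρ p - ρ e := by
  induction l generalizing p with
  | nil => simp [walkWeight]
  | cons v l ih => simp only [walkWeight, ih]; ring

/-- Enough nodes outside `G` remain to extend a list of `j` nodes to one of `k` nodes. -/
theorem exists_fill {α : Type*} [DecidableEq α] {A B G : Finset α} {j k : ℕ}
    (hAB : Disjoint A B) (hG : G ⊆ A ∪ B) (hjk : j ≤ k) (hk : k + #G ≤ j + #A + #B) :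
    ∃ a b : List α, a.Nodup ∧ b.Nodup ∧ (∀ x ∈ a, x ∈ A ∧ x ∉ G) ∧
      (∀ x ∈ b, x ∈ B ∧ x ∉ G) ∧ a.length + b.length + j = k := by
  have hd : Disjoint (A \ G) (B \ G) :=
    Finset.disjoint_of_subset_left sdiff_subset (Finset.disjoint_of_subset_right sdiff_subset hAB)
  have h1 := card_sdiff_add_card_eq_card hG
  rw [card_union_of_disjoint hAB] at h1
  obtain ⟨X, hX, hc⟩ := exists_subset_card_eq (s := (A \ G) ∪ (B \ G)) (n := k - j)
    (by rw [← union_sdiff_distrib]; omega)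
  refine ⟨(X ∩ (A \ G)).toList, (X ∩ (B \ G)).toList, nodup_toList _, nodup_toList _, ?_, ?_, ?_⟩
  · intro x hx
    simp only [mem_toList, mem_inter, mem_sdiff] at hx
    exact hx.2
  · intro x hx
    simp only [mem_toList, mem_inter, mem_sdiff] at hx
    exact hx.2
  · have : X ∩ (A \ G) ∪ X ∩ (B \ G) = X := by
      rw [← inter_union_distrib_left, inter_eq_left.2 hX]
    have h3 := card_union_of_disjoint (s := X ∩ (A \ G)) (t := X ∩ (B \ G))
      (Finset.disjoint_of_subset_left inter_subset_right
        (Finset.disjoint_of_subset_right inter_subset_right hd))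
    rw [this] at h3
    simp only [length_toList]
    omega

/-- All walks from `o` to `e` that visit `k` nodes, first in `A`, then at least one in `B`, then
again in `A`, have weight `β`. -/
def ConstOnTight {α : Type*} (y : α → α → ℝ) (o e : α) (A B : Finset α) (β : ℝ) (k : ℕ) : Prop :=
  ∀ a b c : List α, (∀ x ∈ a, x ∈ A) → (∀ x ∈ b, x ∈ B) → (∀ x ∈ c, x ∈ A) → b ≠ [] →
    (a ++ (b ++ c)).Nodup → (a ++ (b ++ c)).length = k → walkWeight y e o (a ++ (b ++ c)) = β

section Core

variable {α : Type*} [DecidableEq α] {y : α → α → ℝ} {o e : α} {A B : Finset α} {β : ℝ} {k : ℕ}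

theorem ConstOnTight.exists_tail (H : ConstOnTight y o e A B β k) (hAB : Disjoint A B)
    {G : Finset α} {j : ℕ} (hG : G ⊆ A ∪ B) (hjk : j ≤ k) (hk : k + #G ≤ j + #A + #B) :
    ∃ r : List α, ∀ a b : List α, (∀ x ∈ a, x ∈ G ∧ x ∈ A) → (∀ x ∈ b, x ∈ G ∧ x ∈ B) →
      a.Nodup → b.Nodup → b ≠ [] → a.length + b.length = j →
      walkWeight y e o (a ++ (b ++ r)) = β := by
  obtain ⟨a', b', ha', hb', hA', hB', hl⟩ := exists_fill hAB hG hjk hk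
  rw [Finset.disjoint_left] at hAB
  refine ⟨b' ++ a', fun a b ha hb hna hnb hne hlen => ?_⟩
  rw [← List.append_assoc b]
  apply H
  · exact fun x hx => (ha x hx).2
  · intro x hx
    rcases List.mem_append.1 hx with h | h
    exacts [(hb x h).2, (hB' x h).1]
  · exact fun x hx => (hA' x hx).1
  · simp [hne]
  · simp only [List.nodup_append, List.mem_append]
    grind
  · simp only [List.length_append]
    omega

theorem ConstOnTight.exists_head (H : ConstOnTight y o e A B β k) (hAB : Disjoint A B)
    {G : Finset α} {j : ℕ} (hG : G ⊆ A ∪ B) (hjk : j ≤ k) (hk : k + #G ≤ j + #A + #B) :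
    ∃ r : List α, r.length + j = k ∧ (∀ x ∈ r, (x ∈ A ∨ x ∈ B) ∧ x ∉ G) ∧
      r.Pairwise (fun x x' => x ≠ x' ∧ (x' ∈ B ∨ x ∈ A ∧ x' ∈ A)) ∧
      ∀ a b : List α, (∀ x ∈ a, x ∈ G ∧ x ∈ A) → (∀ x ∈ b, x ∈ G ∧ x ∈ B) →
      a.Nodup → b.Nodup → b ≠ [] → a.length + b.length = j →
      walkWeight y e o (r ++ (b ++ a)) = β := by
  obtain ⟨a', b', ha', hb', hA', hB', hl⟩ := exists_fill hAB hG hjk hk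
  rw [Finset.disjoint_left] at hAB
  refine ⟨a' ++ b', by simpa using hl, ?_, ?_, fun a b ha hb hna hnb hne hlen => ?_⟩
  · grind
  · rw [List.pairwise_append]
    refine ⟨ha'.imp_of_mem ?_, hb'.imp_of_mem ?_, ?_⟩ <;> grind
  rw [List.append_assoc, ← List.append_assoc b']
  apply H
  · exact fun x hx => (hA' x hx).1
  · intro x hx
    rcases List.mem_append.1 hx with h | h
    exacts [(hB' x h).1, (hb x h).2]
  · exact fun x hx => (ha x hx).2
  · simp [hne]
  · simp only [List.nodup_append, List.mem_append]
    grind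
  · simp only [List.length_append]
    omega

theorem exists_weights_of_constOnTight_of_source_eq_zero {k' : ℕ} (hAB : Disjoint A B)
    (H : ConstOnTight y o e A B β k) (H' : ConstOnTight y o e A B β k')
    (h0 : ∀ i, i ∈ A ∨ i ∈ B → y o i = 0) (hA : 1 ≤ #A) (hAk : #A + 1 ≤ k) (hkk' : k < k')
    (hk' : k' ≤ #A + #B) :
    ∃ h N : ℝ, (∀ p q, p ∈ A ∨ p ∈ B → q ∈ B → p ≠ q → y p q = 0) ∧
      (∀ z ∈ A, ∀ z' ∈ A, z ≠ z' → y z z' = 0) ∧ (∀ u ∈ B, ∀ z ∈ A, y u z = h) ∧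
      (∀ z ∈ A, y z e = N) ∧ ∀ u ∈ B, y u e = N + h := by
  have hdisj : ∀ ⦃x⦄, x ∈ A → x ∉ B := fun x hx => Finset.disjoint_left.1 hAB hx
  have hne : ∀ z ∈ A, ∀ u ∈ B, z ≠ u := by
    rintro z hz u hu rfl
    exact hdisj hz hu
  have col : ∀ p p' q, p ∈ A ∨ p ∈ B → p' ∈ A ∨ p' ∈ B → q ∈ B → p ≠ q → p' ≠ q →
      y p q = y p' q := by
    intro p p' q hp hp' hq hpq hp'q
    obtain ⟨r, hr⟩ := H.exists_tail hAB (G := {p, p', q}) (j := 2)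
      (by intro x; simp only [mem_insert, mem_singleton, mem_union]; grind) (by omega)
      (by have := card_le_three (a := p) (b := p') (c := q); omega)
    have key : ∀ x, x ∈ A ∨ x ∈ B → x = p ∨ x = p' → y x q + walkWeight y e q r = β := by
      intro x hx hxp
      have hxq : x ≠ q := by grind
      rcases hx with h | h
      · have := hr [x] [q] (by grind) (by grind) (by simp) (by simp) (by simp) (by simp)
        simpa [walkWeight, h0 x (Or.inl h)] using this
      · have := hr [] [x, q] (by grind) (by grind) (by simp) (by simp [hxq]) (by simp) (by simp)
        simpa [walkWeight, h0 x (Or.inr h)] using this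
    linarith [key p hp (Or.inl rfl), key p' hp' (Or.inr rfl)]
  have snoc : ∀ r : List α, r ≠ [] → (∀ x ∈ r, x ∈ A ∨ x ∈ B) → ∃ r' q, r = r' ++ [q] ∧
      (q ∈ A ∨ q ∈ B) := by
    intro r hr hm
    refine ⟨r.dropLast, r.getLast hr, (List.dropLast_append_getLast hr).symm, hm _ (by simp)⟩
  have hB : ∀ u ∈ B, ∀ v ∈ B, u ≠ v → y u e = y v e ∧ ∀ p, p ∈ A ∨ p ∈ B → p ≠ u → p ≠ v →
      y p u = y p v := by
    intro u hu v hv huv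
    obtain ⟨r, hl, hm, -, hr⟩ := H.exists_head hAB (G := {u, v}) (j := 1)
      (by intro x; simp only [mem_insert, mem_singleton, mem_union]; grind) (by omega)
      (by have := card_le_two (a := u) (b := v); omega)
    obtain ⟨r', q, rfl, hq⟩ := snoc r (by rintro rfl; simp at hl; omega) fun x hx => (hm x hx).1
    have hqG := (hm q (by simp)).2
    simp only [mem_insert, mem_singleton, not_or] at hqG
    have e1 := (hr [] [u] (by grind) (by grind) (by simp) (by simp) (by simp) (by simp)).trans
      (hr [] [v] (by grind) (by grind) (by simp) (by simp) (by simp) (by simp)).symm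
    simp only [List.append_assoc, List.cons_append, List.nil_append] at e1
    have e2 := (walkWeight_append_cons_inj ..).1 e1
    obtain ⟨s, hl, hm, -, hs⟩ := H'.exists_head hAB (G := {u, v}) (j := 2)
      (by intro x; simp only [mem_insert, mem_singleton, mem_union]; grind) (by omega)
      (by have := card_le_two (a := u) (b := v); omega)
    obtain ⟨s', q', rfl, hq'⟩ := snoc s (by rintro rfl; simp at hl; omega) fun x hx => (hm x hx).1
    have hqG' := (hm q' (by simp)).2
    simp only [mem_insert, mem_singleton, not_or] at hqG'
    have e3 := (hs [] [u, v] (by grind) (by grind) (by simp) (by simp [huv]) (by simp)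
      (by simp)).trans
      (hs [] [v, u] (by grind) (by grind) (by simp) (by simp [huv.symm]) (by simp) (by simp)).symm
    simp only [List.append_assoc, List.cons_append, List.nil_append] at e3
    have e4 := (walkWeight_append_cons_inj ..).1 e3
    simp only [walkWeight] at e2 e4
    have c1 := col q' q u hq' hq hu hqG'.1 hqG.1
    have c2 := col q' q v hq' hq hv hqG'.2 hqG.2
    have c3 := col u q v (Or.inr hu) hq hv huv hqG.2
    have c4 := col v q u (Or.inr hv) hq hu huv.symm hqG.1
    refine ⟨by linarith, fun p hp hpu hpv => ?_⟩
    have c5 := col p q u hp hq hu hpu hqG.1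
    have c6 := col p q v hp hq hv hpv hqG.2
    linarith
  obtain ⟨z₀, hz₀⟩ := card_pos.1 hA
  obtain ⟨u₀, hu₀, v₀, hv₀, huv₀⟩ := one_lt_card.1 (show 1 < #B by omega)
  have hκ : ∀ p q, p ∈ A ∨ p ∈ B → q ∈ B → p ≠ q → y p q = y z₀ u₀ := by
    intro p q hp hq hpq
    rw [col p z₀ q hp (Or.inl hz₀) hq hpq (hne _ hz₀ _ hq)]
    by_cases h : q = u₀
    · rw [h]
    · exact (hB q hq u₀ hu₀ h).2 z₀ (Or.inl hz₀) (hne _ hz₀ _ hq) (hne _ hz₀ _ hu₀)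
  have hNB : ∀ u ∈ B, y u e = y u₀ e := by
    intro u hu
    by_cases h : u = u₀
    · rw [h]
    · exact (hB u hu u₀ hu₀ h).1
  have hAA : ∀ z ∈ A, ∀ z' ∈ A, z ≠ z' → y z z' = y z₀ u₀ := by
    intro z hz z' hz' hzz
    have : 1 < #A := one_lt_card.2 ⟨z, hz, z', hz', hzz⟩
    obtain ⟨r, hr⟩ := H.exists_tail hAB (G := {z, z', u₀, v₀}) (j := 3)
      (by simp [insert_subset_iff, *]) (by omega)
      (by have := card_le_four (a := z) (b := z') (c := u₀) (d := v₀); omega)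
    have e1 := hr [z, z'] [u₀] (by simp [hz, hz']) (by simp [hu₀]) (by simp [hzz])
      (by simp) (by simp) (by simp)
    have e2 := hr [z] [v₀, u₀] (by simp [hz]) (by simp [hu₀, hv₀]) (by simp)
      (by simp [huv₀.symm]) (by simp) (by simp)
    simp only [List.cons_append, List.nil_append, walkWeight] at e1 e2
    have c1 := hκ z' u₀ (Or.inl hz') hu₀ (hne _ hz' _ hu₀)
    have c2 := hκ z v₀ (Or.inl hz) hv₀ (hne _ hz _ hv₀)
    have c3 := hκ v₀ u₀ (Or.inr hv₀) hu₀ huv₀.symm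
    linarith
  have hBA : ∀ u ∈ B, ∀ z ∈ A, y u z + y z e = y z₀ u₀ + y u₀ e := by
    intro u hu z hz
    obtain ⟨v, hv, huv⟩ := exists_mem_ne (show 1 < #B by omega) u
    obtain ⟨r, hl, hm, -, hr⟩ := H.exists_head hAB (G := {u, v, z}) (j := 2)
      (by simp [insert_subset_iff, *]) (by omega)
      (by have := card_le_three (a := u) (b := v) (c := z); omega)
    have e1 := (hr [z] [u] (by simp [hz]) (by simp [hu]) (by simp) (by simp) (by simp)
      (by simp)).trans
      (hr [] [u, v] (by simp) (by simp [hu, hv]) (by simp) (by simp [huv.symm]) (by simp)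
        (by simp)).symm
    simp only [List.cons_append, List.nil_append] at e1
    have e2 := (walkWeight_append_cons_inj ..).1 e1
    simp only [walkWeight] at e2
    rw [e2, hNB v hv, hκ u v (Or.inr hu) hv huv.symm]
  have hNA : ∀ z ∈ A, y z e = y z₀ e := by
    intro z hz
    by_cases h : z = z₀
    · rw [h]
    obtain ⟨r, hl, hm, -, hr⟩ := H'.exists_head hAB (G := {u₀, z, z₀}) (j := 3)
      (by simp [insert_subset_iff, *]) (by omega)
      (by have := card_le_three (a := u₀) (b := z) (c := z₀); omega)
    have e1 := (hr [z, z₀] [u₀] (by simp [*]) (by simp [hu₀]) (by simp [h]) (by simp) (by simp)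
      (by simp)).trans (hr [z₀, z] [u₀] (by simp [*]) (by simp [hu₀])
      (by simp [Ne.symm h]) (by simp) (by simp) (by simp)).symm
    simp only [List.cons_append, List.nil_append] at e1
    have e2 := (walkWeight_append_cons_inj ..).1 e1
    simp only [walkWeight] at e2
    have c1 := hAA z hz z₀ hz₀ h
    have c2 := hAA z₀ hz₀ z hz (Ne.symm h)
    have c3 := hBA u₀ hu₀ z hz
    have c4 := hBA u₀ hu₀ z₀ hz₀
    linarith
  have count : ∀ l, l = k ∨ l = k' → y z₀ u₀ * (l - 1) + y u₀ e = β := by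
    intro l hl
    have Hl : ConstOnTight y o e A B β l := by rcases hl with rfl | rfl <;> assumption
    obtain ⟨r, hlen, hm, hpw, hr⟩ := Hl.exists_head hAB (G := {u₀}) (j := 1)
      (by simp [hu₀]) (by omega)
      (by rw [card_singleton]; omega)
    have e1 := hr [] [u₀] (by simp [*]) (by simp [hu₀]) (by simp) (by simp) (by simp) (by simp)
    obtain - | ⟨p, r⟩ := r
    · simp at hlen; omega
    have hc : (p :: (r ++ [u₀])).IsChain (fun i j => y i j = y z₀ u₀) := by
      apply List.Pairwise.isChain
      rw [← List.cons_append, List.pairwise_append]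
      refine ⟨hpw.imp_of_mem ?_, by simp, ?_⟩
      · intro x x' hx hx' h
        rcases h.2 with h' | h'
        · exact hκ _ _ (hm x hx).1 h' h.1
        · exact hAA _ h'.1 _ h'.2 h.1
      · intro x hx x' hx'
        have := hm x hx
        simp only [List.mem_singleton, mem_singleton] at hx' this
        subst hx'
        exact hκ _ _ this.1 hu₀ this.2
    have e2 := walkWeight_concat_of_isChain y e u₀ _ p r hc
    simp only [List.append_nil, List.cons_append, walkWeight, h0 p (hm p (by simp)).1, e2] at e1
    have : (l : ℝ) = r.length + 1 + 1 := by
      rw [← hlen]; push_cast [List.length_cons]; ring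
    rw [this]
    linarith
  have hzero : y z₀ u₀ = 0 := by
    have e1 := count k (Or.inl rfl)
    have e2 := count k' (Or.inr rfl)
    have h : y z₀ u₀ * ((k' : ℝ) - k) = 0 := by linarith
    have hne : (k' : ℝ) - k ≠ 0 := sub_ne_zero.2 (by exact_mod_cast hkk'.ne')
    exact (mul_eq_zero.1 h).resolve_right hne
  simp only [hzero, zero_add] at hκ hAA hBA
  refine ⟨y u₀ e - y z₀ e, y z₀ e, hκ, hAA, fun u hu z hz => ?_, hNA, fun u hu => ?_⟩
  · linarith [hBA u hu z hz, hNA z hz]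
  · linarith [hNB u hu]

theorem exists_potential_of_constOnTight {k' : ℕ} (hAB : Disjoint A B)
    (hoA : o ∉ A) (hoB : o ∉ B) (heA : e ∉ A) (heB : e ∉ B) (hoe : o ≠ e)
    (H : ConstOnTight y o e A B β k) (H' : ConstOnTight y o e A B β k')
    (hA : 1 ≤ #A) (hAk : #A + 1 ≤ k) (hkk' : k < k') (hk' : k' ≤ #A + #B) :
    ∃ (π : α → ℝ) (h : ℝ), ∀ i j, (i = o ∨ i ∈ A ∨ i ∈ B) → (j = e ∨ j ∈ A ∨ j ∈ B) → i ≠ j →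
      ¬ (i = o ∧ j = e) → y i j = π i - π j + h * if i ∉ B ∧ j ∈ B then 1 else 0 := by
  let ρ : α → ℝ := fun v => if v = o ∨ v = e then 0 else y o v
  have key : ∀ {l}, ConstOnTight y o e A B β l →
      ConstOnTight (fun i j => y i j + ρ i - ρ j) o e A B β l := by
    intro l Hl a b c ha hb hc hne hnd hlen
    rw [walkWeight_add_sub, Hl a b c ha hb hc hne hnd hlen]
    simp [ρ]
  have hρo : ρ o = 0 := by simp [ρ]
  have hρe : ρ e = 0 := by simp [ρ]
  obtain ⟨h, N, h1, h2, h3, h4, h5⟩ := exists_weights_of_constOnTight_of_source_eq_zero hAB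
    (key H) (key H') (by intro i hi; simp only [ρ]; grind) hA hAk hkk' hk'
  have hdisj : ∀ ⦃x⦄, x ∈ A → x ∉ B := fun x hx => Finset.disjoint_left.1 hAB hx
  refine ⟨fun v => - ρ v + if v = e then - N else if v ∈ B then h else 0, h, ?_⟩
  intro i j hi hj hij hoe'
  by_cases hio : i = o
  · subst hio
    have : ρ j = y i j := by simp only [ρ]; grind
    have hje : j ≠ e := by grind
    simp only [this, hρo, hoe, hoB, hje]
    split_ifs <;> grind
  · replace hi := hi.resolve_left hio
    have hie : i ≠ e := by grind
    by_cases hje : j = e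
    · subst hje
      rcases hi with hi | hi
      · have := h4 i hi
        simp only [hρe] at this
        simp only [hρe, hie, heB, hdisj hi, and_false, if_true, if_false]
        linarith
      · have := h5 i hi
        simp only [hρe] at this
        simp only [hρe, hie, heB, hi, and_false, if_true, if_false]
        linarith
    · replace hj := hj.resolve_left hje
      simp only [hie, hje, if_false]
      by_cases hiB : i ∈ B <;> by_cases hjB : j ∈ B
      · have := h1 i j (Or.inr hiB) hjB hij
        simp only [hiB, hjB, not_true, false_and, if_true, if_false]
        linarith
      · have := h3 i hiB j (hj.resolve_right hjB)
        simp only [hiB, hjB, not_true, false_and, if_true, if_false]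
        linarith
      · have := h1 i j hi hjB hij
        simp only [hiB, hjB, not_false_iff, true_and, if_true, if_false]
        linarith
      · have := h2 i (hi.resolve_right hiB) j (hj.resolve_right hjB) hij
        simp only [hiB, hjB, and_false, if_false]
        linarith

end Core

/-- The nodes of the walk that starts in `p`, traverses the list, and ends in `e`. -/
def walkNode {α : Type*} (e : α) : α → (l : List α) → Fin (l.length + 2) → α
  | p, [] => Fin.cons p fun _ => e
  | p, v :: l => Fin.cons p (walkNode e v l)

theorem walkNode_zero {α : Type*} (e p : α) (l : List α) : walkNode e p l 0 = p := by
  cases l <;> rfl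

theorem walkNode_last {α : Type*} (e p : α) (l : List α) :
    walkNode e p l (Fin.last _) = e := by
  induction l generalizing p with
  | nil => rfl
  | cons v l ih => exact ih v

theorem walkNode_mem {α : Type*} (e p : α) (l : List α) (i) :
    walkNode e p l i ∈ p :: (l ++ [e]) := by
  induction l generalizing p with
  | nil => refine Fin.cases ?_ (fun j => ?_) i <;> simp [walkNode]
  | cons v l ih =>
    refine Fin.cases ?_ (fun j => ?_) i
    · simp [walkNode]
    · exact List.mem_cons_of_mem _ (ih v j)

theorem walkNode_injective {α : Type*} (e p : α) (l : List α) (h : (p :: (l ++ [e])).Nodup) :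
    Function.Injective (walkNode e p l) := by
  induction l generalizing p with
  | nil =>
    rw [walkNode, Fin.cons_injective_iff]
    refine ⟨?_, fun i j _ => Subsingleton.elim (α := Fin 1) i j⟩
    rintro ⟨i, hi⟩
    simp_all
  | cons v l ih =>
    rw [List.nodup_cons] at h
    rw [walkNode, Fin.cons_injective_iff]
    refine ⟨?_, ih v h.2⟩
    rintro ⟨i, rfl⟩
    exact h.1 (walkNode_mem e v l i)

theorem sum_walkNode {α : Type*} (y : α → α → ℝ) (e p : α) (l : List α) :
    ∑ i : Fin (l.length + 1), y (walkNode e p l i.castSucc) (walkNode e p l i.succ) =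
      walkWeight y e p l := by
  induction l generalizing p with
  | nil => simp [walkNode, walkWeight]
  | cons v l ih =>
    rw [walkWeight, ← ih v]
    refine (Fin.sum_univ_succ (n := l.length + 1) _).trans (congrArg (· + _) ?_)
    change y p (walkNode e v l 0) = y p v
    rw [walkNode_zero]

section Paths

variable {n : ℕ}

/-- The set of arcs between consecutive nodes of a sequence. -/
def arcImage {α : Type*} [DecidableEq α] {k : ℕ} (f : Fin (k + 1) → α) : Finset (α × α) :=
  univ.image fun i : Fin k => (f i.castSucc, f i.succ)

theorem arcs_injective {α : Type*} {k : ℕ} {f : Fin (k + 1) → α} (hf : Function.Injective f) :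
    Function.Injective fun i : Fin k => (f i.castSucc, f i.succ) := fun _ _ h =>
  Fin.castSucc_injective _ (hf (Prod.ext_iff.1 h).1)

theorem card_arcImage {α : Type*} [DecidableEq α] {k : ℕ} {f : Fin (k + 1) → α}
    (hf : Function.Injective f) : #(arcImage f) = k := by
  rw [arcImage, card_image_of_injective _ (arcs_injective hf), card_univ, Fintype.card_fin]

theorem sum_arcImage {α : Type*} [DecidableEq α] {k : ℕ} {f : Fin (k + 1) → α}
    (hf : Function.Injective f) (g : α × α → ℝ) :
    ∑ a ∈ arcImage f, g a = ∑ i : Fin k, g (f i.castSucc, f i.succ) := by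
  rw [arcImage, sum_image fun _ _ _ _ h => arcs_injective hf h]

theorem map_incVec {N : ℕ} (φ : (Fin N → Fin N → ℝ) →ₗ[ℝ] ℝ) (P : Finset (Fin N × Fin N)) :
    φ (incVec P) = ∑ a ∈ P, φ (Pi.single a.1 (Pi.single a.2 1)) := by
  rw [← map_sum]
  congr 1
  ext i j
  simp only [incVec, Finset.sum_apply, Pi.single_apply]
  rw [← sum_ite_eq P (i, j) fun _ => (1 : ℝ)]
  refine sum_congr rfl fun a _ => ?_
  by_cases h : i = a.1 <;> by_cases h' : j = a.2 <;> simp [Prod.ext_iff, h, h']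

/-- A list of distinct inner nodes determines a `(0,n)`-path. -/
theorem exists_isTildePath_of_list (l : List (Fin (n + 1))) (hn : n ≠ 0) (hl : l ≠ [])
    (hnd : l.Nodup) (h0 : 0 ∉ l) (he : Fin.last n ∉ l) :
    ∃ P, IsTildePath n P ∧ #P = l.length + 1 ∧
      ∀ φ : (Fin (n + 1) → Fin (n + 1) → ℝ) →ₗ[ℝ] ℝ, φ (incVec P) =
        walkWeight (fun i j => φ (Pi.single i (Pi.single j 1))) (Fin.last n) 0 l := by
  have h0e : (0 : Fin (n + 1)) ≠ Fin.last n := by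
    rw [Ne, eq_comm, Fin.last_eq_zero_iff]
    exact hn
  have hf : Function.Injective (walkNode (Fin.last n) 0 l) := by
    apply walkNode_injective
    simp only [List.nodup_cons, List.mem_append, List.nodup_append, List.mem_singleton]
    grind
  set f := walkNode (Fin.last n) 0 l with hfdef
  have hf0 : f 0 = 0 := walkNode_zero _ _ _
  have hfe : f (Fin.last _) = Fin.last n := walkNode_last _ _ _
  refine ⟨arcImage f, ⟨?_, _, f, hf, hf0, hfe, rfl⟩, card_arcImage hf, fun φ => ?_⟩
  · intro a ha
    obtain ⟨i, -, rfl⟩ := mem_image.1 ha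
    have hlen := List.length_pos_iff.2 hl
    simp only [tA, mem_filter, mem_univ, true_and]
    refine ⟨fun h => ?_, fun h => ?_, fun h => ?_, fun h => ?_⟩
    · exact (Fin.castSucc_lt_succ (i := i)).ne (hf h)
    · exact Fin.succ_ne_zero i (hf (h.trans hf0.symm))
    · exact (Fin.castSucc_lt_last i).ne (hf (h.trans hfe.symm))
    · have h1 := Fin.ext_iff.1 (hf (h.1.trans hf0.symm))
      have h2 := Fin.ext_iff.1 (hf (h.2.trans hfe.symm))
      rw [Fin.val_castSucc, Fin.val_zero] at h1
      rw [Fin.val_succ, Fin.val_last] at h2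
      omega
  · rw [map_incVec, sum_arcImage hf, ← sum_walkNode]

theorem IsTildePath.exists_nodes {P : Finset (Fin (n + 1) × Fin (n + 1))} (hP : IsTildePath n P) :
    ∃ f : Fin (#P + 1) → Fin (n + 1), Function.Injective f ∧ f 0 = 0 ∧
      f (Fin.last _) = Fin.last n ∧ (∀ i : Fin #P, (f i.castSucc, f i.succ) ∈ tA n) ∧
      ∀ g : Fin (n + 1) × Fin (n + 1) → ℝ,
        ∑ a ∈ P, g a = ∑ i : Fin #P, g (f i.castSucc, f i.succ) := by
  obtain ⟨hPA, k, f, hf, hf0, hfe, hPf⟩ := hP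
  obtain rfl : #P = k := by rw [hPf]; exact card_arcImage hf
  refine ⟨f, hf, hf0, hfe, fun i => hPA ?_, fun g => ?_⟩
  · exact hPf.symm.subset (mem_image_of_mem _ (mem_univ i))
  · conv_lhs => rw [hPf]
    exact sum_arcImage hf g

/-- The left-hand side of the min-cut inequality as a linear functional. -/
noncomputable def cutFun (S : Finset (Fin (n + 1))) :
    (Fin (n + 1) → Fin (n + 1) → ℝ) →ₗ[ℝ] ℝ :=
  ∑ a ∈ (tA n).filter (fun a => a.1 ∈ S ∧ a.2 ∉ S),
    LinearMap.proj (R := ℝ) (φ := fun _ => ℝ) a.2 ∘ₗ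
      LinearMap.proj (R := ℝ) (φ := fun _ => Fin (n + 1) → ℝ) a.1

theorem cutFun_apply (S : Finset (Fin (n + 1))) (x : Fin (n + 1) → Fin (n + 1) → ℝ) :
    cutFun S x = ∑ a ∈ (tA n).filter (fun a => a.1 ∈ S ∧ a.2 ∉ S), x a.1 a.2 := by
  simp [cutFun]

theorem cutFun_single (S : Finset (Fin (n + 1))) (i j : Fin (n + 1)) :
    cutFun S (Pi.single i (Pi.single j 1)) = if (i, j) ∈ tA n ∧ i ∈ S ∧ j ∉ S then 1 else 0 := by
  rw [cutFun_apply]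
  have : ∀ a : Fin (n + 1) × Fin (n + 1),
      (Pi.single i (Pi.single j 1) : Fin (n + 1) → Fin (n + 1) → ℝ) a.1 a.2 =
        if (i, j) = a then 1 else 0 := by
    intro a
    by_cases h : a.1 = i <;> by_cases h' : a.2 = j <;> simp [Prod.ext_iff, h, h', eq_comm]
  simp only [this, sum_ite_eq, mem_filter]

theorem cutFun_incVec (S : Finset (Fin (n + 1))) {P : Finset (Fin (n + 1) × Fin (n + 1))}
    (hP : P ⊆ tA n) :
    cutFun S (incVec P) = ∑ a ∈ P, if a.1 ∈ S ∧ a.2 ∉ S then 1 else 0 := by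
  rw [map_incVec]
  exact sum_congr rfl fun a ha => by simp [cutFun_single, hP ha]

theorem cutFun_single_eq_zero {S : Finset (Fin (n + 1))} {i j : Fin (n + 1)}
    (h : i ∉ S ∨ j ∈ S) : cutFun S (Pi.single i (Pi.single j 1)) = 0 := by
  rw [cutFun_single, if_neg]
  tauto

theorem cutFun_single_eq_one {S : Finset (Fin (n + 1))} (h0 : 0 ∈ S) (he : Fin.last n ∈ S)
    {i j : Fin (n + 1)} (hi : i ∈ S) (hj : j ∉ S) (hin : i ≠ Fin.last n) :
    cutFun S (Pi.single i (Pi.single j 1)) = 1 := by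
  rw [cutFun_single, if_pos]
  refine ⟨?_, hi, hj⟩
  simp only [tA, mem_filter, mem_univ, true_and]
  exact ⟨ne_of_mem_of_not_mem hi hj, (ne_of_mem_of_not_mem h0 hj).symm, hin,
    fun h => hj (h.2 ▸ he)⟩

/-- A path with more nodes than `S` leaves `S`. -/
theorem one_le_cutFun_incVec {S : Finset (Fin (n + 1))} (h0 : 0 ∈ S)
    {P : Finset (Fin (n + 1) × Fin (n + 1))} (hP : IsTildePath n P) (hS : #S ≤ #P) :
    1 ≤ cutFun S (incVec P) := by
  obtain ⟨f, hf, hf0, hfe, hfA, hsum⟩ := hP.exists_nodes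
  rw [cutFun_incVec S hP.1, hsum]
  have hex : ∃ i : Fin #P, f i.castSucc ∈ S ∧ f i.succ ∉ S := by
    by_contra! h
    have hall : ∀ i, f i ∈ S := by
      intro i
      induction i using Fin.induction with
      | zero => rwa [hf0]
      | succ i ih => exact h i ih
    have : #(univ.image f) ≤ #S := card_le_card fun x hx => by
      obtain ⟨i, -, rfl⟩ := mem_image.1 hx
      exact hall i
    rw [card_image_of_injective _ hf, card_univ, Fintype.card_fin] at this
    omega
  obtain ⟨i, hi⟩ := hex
  refine le_trans ?_ (single_le_sum (fun j _ => ?_) (mem_univ i))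
  · rw [if_pos hi]
  · split_ifs <;> norm_num

/-- A path leaves `{0, n}` at most once. -/
theorem cutFun_incVec_le_one {P : Finset (Fin (n + 1) × Fin (n + 1))} (hP : IsTildePath n P) :
    cutFun {0, Fin.last n} (incVec P) ≤ 1 := by
  obtain ⟨f, hf, hf0, hfe, hfA, hsum⟩ := hP.exists_nodes
  rw [cutFun_incVec _ hP.1, hsum]
  calc _ ≤ ∑ i : Fin #P, if f i.castSucc = 0 then (1 : ℝ) else 0 := by
        refine sum_le_sum fun i _ => ?_
        have := (mem_filter.1 (hfA i)).2.2.2.1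
        simp only [mem_insert, mem_singleton]
        split_ifs <;> simp_all
    _ = #(univ.filter fun i : Fin #P => f i.castSucc = 0) := by simp
    _ ≤ 1 := by
        rw [Nat.cast_le_one, card_le_one]
        intro i hi j hj
        rw [mem_filter] at hi hj
        exact Fin.castSucc_injective _ (hf (hi.2.trans hj.2.symm))

theorem map_incVec_of_potential {φ : (Fin (n + 1) → Fin (n + 1) → ℝ) →ₗ[ℝ] ℝ}
    {S : Finset (Fin (n + 1))} {π : Fin (n + 1) → ℝ} {h : ℝ}
    (H : ∀ i j, (i, j) ∈ tA n → φ (Pi.single i (Pi.single j 1)) =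
      π i - π j + h * if i ∈ S ∧ j ∉ S then 1 else 0)
    {P : Finset (Fin (n + 1) × Fin (n + 1))} (hP : IsTildePath n P) :
    φ (incVec P) = h * cutFun S (incVec P) + (π 0 - π (Fin.last n)) := by
  obtain ⟨f, hf, hf0, hfe, hfA, hsum⟩ := hP.exists_nodes
  have htel : ∑ i : Fin #P, (π (f i.castSucc) - π (f i.succ)) = π 0 - π (Fin.last n) := by
    rw [sum_sub_distrib, ← hf0, ← hfe]
    have h1 := Fin.sum_univ_castSucc fun i => π (f i)
    have h2 := Fin.sum_univ_succ fun i => π (f i)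
    linarith
  rw [map_incVec, cutFun_incVec S hP.1, hsum, hsum, sum_congr rfl fun i _ => H _ _ (hfA i),
    sum_add_distrib, htel, mul_sum, add_comm]

section Walks

variable {S : Finset (Fin (n + 1))}

theorem walkWeight_cutFun_nonneg (p : Fin (n + 1)) (l : List (Fin (n + 1))) :
    0 ≤ walkWeight (fun i j => cutFun S (Pi.single i (Pi.single j 1))) (Fin.last n) p l := by
  have h : ∀ i j : Fin (n + 1), 0 ≤ cutFun S (Pi.single i (Pi.single j 1)) := fun i j => by
    simp only [cutFun_single]
    split_ifs <;> norm_num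
  induction l generalizing p with
  | nil => exact h _ _
  | cons v l ih => exact add_nonneg (h _ _) (ih v)

theorem walkWeight_cutFun_eq_zero (he : Fin.last n ∈ S) (p : Fin (n + 1)) (b c : List (Fin (n + 1)))
    (hp : p ∉ S ∨ b = []) (hb : ∀ x ∈ b, x ∉ S) (hc : ∀ x ∈ c, x ∈ S) :
    walkWeight (fun i j => cutFun S (Pi.single i (Pi.single j 1))) (Fin.last n) p (b ++ c) = 0 := by
  induction b generalizing p with
  | nil =>
    induction c generalizing p with
    | nil => exact cutFun_single_eq_zero (Or.inr he)
    | cons v c ih =>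
      rw [List.forall_mem_cons] at hc
      rw [List.nil_append, walkWeight, cutFun_single_eq_zero (Or.inr hc.1), zero_add]
      exact ih hc.2 v (Or.inr rfl)
  | cons v b ih =>
    rw [List.forall_mem_cons] at hb
    rw [List.cons_append, walkWeight, cutFun_single_eq_zero (Or.inl (by simpa using hp)),
      ih v (Or.inl hb.1) hb.2, add_zero]

theorem walkWeight_cutFun_eq_one (h0 : 0 ∈ S) (he : Fin.last n ∈ S) (p : Fin (n + 1))
    (a b c : List (Fin (n + 1))) (hp : p ∈ S) (hpn : p ≠ Fin.last n)
    (ha : ∀ x ∈ a, x ∈ S ∧ x ≠ Fin.last n) (hb : ∀ x ∈ b, x ∉ S) (hc : ∀ x ∈ c, x ∈ S)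
    (hne : b ≠ []) :
    walkWeight (fun i j => cutFun S (Pi.single i (Pi.single j 1))) (Fin.last n) p (a ++ (b ++ c)) =
      1 := by
  induction a generalizing p with
  | nil =>
    obtain ⟨v, b, rfl⟩ := List.exists_cons_of_ne_nil hne
    rw [List.forall_mem_cons] at hb
    rw [List.nil_append, List.cons_append, walkWeight, cutFun_single_eq_one h0 he hp hb.1 hpn,
      walkWeight_cutFun_eq_zero he v b c (Or.inl hb.1) hb.2 hc, add_zero]
  | cons v a ih =>
    rw [List.forall_mem_cons] at ha
    rw [List.cons_append, walkWeight, cutFun_single_eq_zero (Or.inr ha.1.1),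
      ih v ha.1.1 ha.1.2 ha.2, zero_add]

end Walks

end Paths

section Facets

variable {n m : ℕ} {S : Finset (Fin (n + 1))} {c : Fin m → ℕ}

/-- The incidence vectors spanning the polytope. -/
abbrev pathVectors (n : ℕ) {m : ℕ} (c : Fin m → ℕ) : Set (Fin (n + 1) → Fin (n + 1) → ℝ) :=
  {x | ∃ P, IsTildePath n P ∧ (∃ p, P.card = c p) ∧ x = incVec P}

/-- Every list of the right length yields a vertex of the polytope. -/
theorem exists_mem_pathVectors (l : List (Fin (n + 1))) (hn : n ≠ 0) (hl : l ≠ [])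
    (hnd : l.Nodup) (h0 : 0 ∉ l) (he : Fin.last n ∉ l) (p : Fin m) (hp : l.length + 1 = c p) :
    ∃ x ∈ pathVectors n c, ∀ φ : (Fin (n + 1) → Fin (n + 1) → ℝ) →ₗ[ℝ] ℝ, φ x =
        walkWeight (fun i j => φ (Pi.single i (Pi.single j 1))) (Fin.last n) 0 l := by
  obtain ⟨P, hP, hcard, hφ⟩ := exists_isTildePath_of_list l hn hl hnd h0 he
  exact ⟨_, ⟨P, hP, ⟨p, hcard.trans hp⟩, rfl⟩, hφ⟩

/-- The inner nodes of a node set. -/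
abbrev innerNodes (T : Finset (Fin (n + 1))) : Finset (Fin (n + 1)) :=
  (T.erase 0).erase (Fin.last n)

theorem card_innerNodes (hn : n ≠ 0) (h0 : 0 ∈ S) (he : Fin.last n ∈ S) :
    #(innerNodes S) + 2 = #S := by
  have h : Fin.last n ≠ 0 := by rwa [Ne, Fin.last_eq_zero_iff]
  have h1 := card_erase_add_one (mem_erase.2 ⟨h, he⟩)
  have h2 := card_erase_add_one h0
  rw [innerNodes]
  omega

theorem one_le_cutFun (h0 : 0 ∈ S) (hS : ∀ p, #S ≤ c p) {x : Fin (n + 1) → Fin (n + 1) → ℝ}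
    (hx : x ∈ pathPolytope n c) : 1 ≤ cutFun S x := by
  refine convexHull_min (t := {x | 1 ≤ cutFun S x}) ?_ ?_ hx
  · rintro _ ⟨P, hP, ⟨p, hp⟩, rfl⟩
    exact one_le_cutFun_incVec h0 hP (hp ▸ hS p)
  · exact convex_halfSpace_ge (cutFun S).isLinear 1

theorem card_le_of_one_le_cutFun (hn : n ≠ 0) (h0 : 0 ∈ S) (he : Fin.last n ∈ S) (p : Fin m)
    (hp : 2 ≤ c p) (H : ∀ x ∈ pathPolytope n c, 1 ≤ cutFun S x) : #S ≤ c p := by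
  by_contra! hlt
  have hA := card_innerNodes hn h0 he
  obtain ⟨X, hX, hXc⟩ := exists_subset_card_eq (s := innerNodes S) (n := c p - 1) (by omega)
  have hmem : ∀ x ∈ X.toList, x ≠ Fin.last n ∧ x ≠ 0 ∧ x ∈ S := by
    intro x hx
    simpa using hX (mem_toList.1 hx)
  obtain ⟨x, hx, hφ⟩ := exists_mem_pathVectors (c := c) X.toList hn
    (by rw [Ne, ← List.length_eq_zero_iff, length_toList]; omega) (nodup_toList X)
    (fun h => (hmem _ h).2.1 rfl) (fun h => (hmem _ h).1 rfl) p (by rw [length_toList]; omega)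
  have h1 := H x (subset_convexHull ℝ _ hx)
  have h2 := walkWeight_cutFun_eq_zero he 0 [] X.toList (Or.inr rfl) (by simp)
    fun x hx => (hmem x hx).2.2
  rw [hφ (cutFun S)] at h1
  rw [List.nil_append] at h2
  linarith

theorem two_lt_card_of_isFacetGE (hn : n ≠ 0) (h0 : 0 ∈ S) (he : Fin.last n ∈ S)
    (H : IsFacetGE (pathPolytope n c) (cutFun S) 1) : 2 < #S := by
  have hA := card_innerNodes hn h0 he
  by_contra! h
  have hS : {0, Fin.last n} = S := by
    refine eq_of_subset_of_card_le (by simp [insert_subset_iff, h0, he]) ?_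
    rw [card_pair (by rwa [Ne, eq_comm, Fin.last_eq_zero_iff])]
    exact h
  have hle : ∀ x ∈ pathPolytope n c, cutFun S x ≤ 1 := by
    intro x hx
    refine convexHull_min (t := {x | cutFun S x ≤ 1}) ?_ ?_ hx
    · rintro _ ⟨P, hP, -, rfl⟩
      rw [← hS]
      exact cutFun_incVec_le_one hP
    · exact convex_halfSpace_le (cutFun S).isLinear 1
  have hF : {x ∈ pathPolytope n c | cutFun S x = 1} = pathPolytope n c :=
    Set.sep_eq_self_iff_mem_true.2 fun x hx => (hle x hx).antisymm (H.1 x hx)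
  have := H.2
  rw [hF] at this
  omega

theorem isFacetGE_cutFun (hn : n ≠ 0) (h0 : 0 ∈ S) (he : Fin.last n ∈ S) (hcn : ∀ p, c p ≤ n)
    {p q : Fin m} (hp : ∀ r, c p ≤ c r) (hpq : c p < c q) (hS3 : 3 ≤ #S) (hS : #S ≤ c p) :
    IsFacetGE (pathPolytope n c) (cutFun S) 1 := by
  refine ⟨fun x => one_le_cutFun h0 fun r => hS.trans (hp r), ?_⟩
  have hA := card_innerNodes hn h0 he
  set A := innerNodes S with hAdef
  set B := univ \ S with hBdef
  have hB : #B + #S = n + 1 := by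
    rw [card_sdiff_add_card_eq_card (subset_univ S), card_univ, Fintype.card_fin]
  have hcq := hcn q
  have mA : ∀ x, x ∈ A ↔ x ≠ Fin.last n ∧ x ≠ 0 ∧ x ∈ S := by simp [hAdef]
  have mB : ∀ x, x ∈ B ↔ x ∉ S := by simp [hBdef]
  have hAB : Disjoint A B := Finset.disjoint_left.2 fun x hx hx' => (mB x).1 hx' ((mA x).1 hx).2.2
  have h0A : 0 ∉ A := fun h => ((mA _).1 h).2.1 rfl
  have h0B : 0 ∉ B := fun h => (mB _).1 h h0
  have heA : Fin.last n ∉ A := fun h => ((mA _).1 h).1 rfl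
  have heB : Fin.last n ∉ B := fun h => (mB _).1 h he
  have h0e : (0 : Fin (n + 1)) ≠ Fin.last n := by rwa [Ne, eq_comm, Fin.last_eq_zero_iff]
  have vert : ∀ (l : List (Fin (n + 1))) (r : Fin m), l ≠ [] → l.Nodup →
      (∀ x ∈ l, x ∈ A ∨ x ∈ B) → l.length = c r - 1 → _ := fun l r hl hnd hm hlen =>
    exists_mem_pathVectors (c := c) l hn hl hnd
      (fun h => (hm _ h).elim h0A h0B) (fun h => (hm _ h).elim heA heB) r (by
        have := List.length_pos_iff.2 hl; omega)
  have tight : ∀ (a b d : List (Fin (n + 1))), (∀ x ∈ a, x ∈ A) → (∀ x ∈ b, x ∈ B) →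
      (∀ x ∈ d, x ∈ A) → b ≠ [] → walkWeight
        (fun i j => cutFun S (Pi.single i (Pi.single j 1))) (Fin.last n) 0 (a ++ (b ++ d)) = 1 :=
    fun a b d ha hb hd hne => walkWeight_cutFun_eq_one h0 he 0 a b d h0 h0e
      (fun x hx => ⟨((mA x).1 (ha x hx)).2.2, ((mA x).1 (ha x hx)).1⟩)
      (fun x hx => (mB x).1 (hb x hx)) (fun x hx => ((mA x).1 (hd x hx)).2.2) hne
  obtain ⟨z, hz⟩ := card_pos.1 (show 0 < #A by omega)
  obtain ⟨u, hu, v, hv, huv⟩ := one_lt_card.1 (show 1 < #B by omega)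
  obtain ⟨x₀, hx₀, hx₀1⟩ : ∃ x ∈ pathVectors n c, cutFun S x ≠ 1 := by
    have huz : u ≠ z := fun h => Finset.disjoint_left.1 hAB hz (h ▸ hu)
    have hvz : v ≠ z := fun h => Finset.disjoint_left.1 hAB hz (h ▸ hv)
    have hG : #({u, z, v} : Finset (Fin (n + 1))) = 3 := card_eq_three.2
      ⟨u, z, v, huz, huv, hvz.symm, rfl⟩
    obtain ⟨a, b, ha, hb, hmA, hmB, hlen⟩ := exists_fill (k := c q - 1) (j := 3) hAB
      (G := {u, z, v}) (by simp [insert_subset_iff, hu, hv, hz]) (by omega) (by omega)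
    have hdis : a.Disjoint b := fun x hx hx' =>
      Finset.disjoint_left.1 hAB (hmA x hx).1 (hmB x hx').1
    have hnd : (u :: z :: v :: (a ++ b)).Nodup := by
      have hG : ∀ x ∈ a ++ b, x ∉ ({u, z, v} : Finset (Fin (n + 1))) := by
        intro x hx
        exact (List.mem_append.1 hx).elim (fun h => (hmA x h).2) fun h => (hmB x h).2
      have h1 := fun h => hG u h (by simp)
      have h2 := fun h => hG z h (by simp)
      have h3 := fun h => hG v h (by simp)
      have h4 : (a ++ b).Nodup := ha.append hb hdis
      simp only [List.nodup_cons, List.mem_cons, not_or]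
      exact ⟨⟨huz, huv, h1⟩, ⟨hvz.symm, h2⟩, h3, h4⟩
    obtain ⟨x, hx, hφ⟩ := vert (u :: z :: v :: (a ++ b)) q (by simp) hnd
      (by
        intro x hx
        simp only [List.mem_cons, List.mem_append] at hx
        rcases hx with rfl | rfl | rfl | hx | hx
        exacts [Or.inr hu, Or.inl hz, Or.inr hv, Or.inl (hmA x hx).1, Or.inr (hmB x hx).1])
      (by simp only [List.length_cons, List.length_append]; omega)
    refine ⟨x, hx, ?_⟩
    have hzS := (mA z).1 hz
    rw [hφ, walkWeight, walkWeight, walkWeight,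
      cutFun_single_eq_one h0 he h0 ((mB u).1 hu) h0e,
      cutFun_single_eq_zero (Or.inl ((mB u).1 hu)),
      cutFun_single_eq_one h0 he hzS.2.2 ((mB v).1 hv) hzS.1]
    have := walkWeight_cutFun_nonneg (S := S) v (a ++ b)
    exact fun h => by linarith
  obtain ⟨x₁, hx₁, hx₁1⟩ : ∃ x ∈ pathVectors n c, cutFun S x = 1 := by
    obtain ⟨a, b, ha, hb, hmA, hmB, hlen⟩ := exists_fill (k := c p - 1) (j := 1) hAB
      (G := {u}) (by simp [hu]) (by omega) (by rw [card_singleton]; omega)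
    have hdis : a.Disjoint b := fun x hx hx' =>
      Finset.disjoint_left.1 hAB (hmA x hx).1 (hmB x hx').1
    have hnd : (a ++ (u :: b ++ [])).Nodup := by
      have h1 : u ∉ a := fun h => (hmA u h).2 (mem_singleton_self u)
      have h2 : u ∉ b := fun h => (hmB u h).2 (mem_singleton_self u)
      rw [List.append_nil]
      exact ha.append (hb.cons h2) (by simpa [h1] using hdis)
    obtain ⟨x, hx, hφ⟩ := vert (a ++ (u :: b ++ [])) p (by simp) hnd
      (by
        intro x hx
        simp only [List.append_nil, List.mem_cons, List.mem_append] at hx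
        rcases hx with hx | rfl | hx
        exacts [Or.inl (hmA x hx).1, Or.inr hu, Or.inr (hmB x hx).1])
      (by simp only [List.append_nil, List.length_cons, List.length_append]
          omega)
    refine ⟨x, hx, ?_⟩
    rw [hφ]
    exact tight a (u :: b) [] (fun x hx => (hmA x hx).1)
      (List.forall_mem_cons.2 ⟨hu, fun x hx => (hmB x hx).1⟩) (by simp) (by simp)
  refine adim_face_add_one hx₀ hx₁ hx₀1 hx₁1 fun φ β hφβ => ?_
  have hconst : ∀ r, ConstOnTight (fun i j => φ (Pi.single i (Pi.single j 1))) 0 (Fin.last n) A B β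
      (c r - 1) := by
    intro r a b d ha hb hd hne hnd hlen
    obtain ⟨x, hx, hφ⟩ := vert (a ++ (b ++ d)) r (by simp [hne]) hnd
      (by
        intro x hx
        simp only [List.mem_append] at hx
        rcases hx with hx | hx | hx
        exacts [Or.inl (ha x hx), Or.inr (hb x hx), Or.inl (hd x hx)])
      hlen
    rw [← hφ φ]
    exact hφβ x hx ((hφ _).trans (tight a b d ha hb hd hne))
  obtain ⟨π, h, hπ⟩ := exists_potential_of_constOnTight hAB h0A h0B heA heB h0e
    (hconst p) (hconst q) (by omega) (by omega) (by omega) (by omega)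
  refine ⟨h, π 0 - π (Fin.last n), ?_⟩
  rintro _ ⟨P, hP, -, rfl⟩
  refine map_incVec_of_potential (fun i j hij => ?_) hP
  simp only [tA, mem_filter, mem_univ, true_and] at hij
  rw [hπ i j ?_ ?_ hij.1 hij.2.2.2]
  · simp only [mB, not_not]
  · rw [mA, mB]
    tauto
  · rw [mA, mB]
    tauto

end Facets

/-- **Theorem 11 (min-cut inequalities).**  Let `n ≥ 4`, let `c` be a cardinality
sequence in `CS` (`m ≥ 2`, `2 ≤ c 0 < ⋯ < c (m-1) ≤ n`, `c ≠ (2,3)`), and let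
`S ⊂ Ñ_n` with `0, n ∈ S`.  The min-cut inequality `x((S:Ñ_n∖S)) ≥ 1` is valid for
`P_{0,n-path}^c(D̃_n)` if and only if `|S| ≤ c 0`, and it defines a facet of
`P_{0,n-path}^c(D̃_n)` if and only if `3 ≤ |S| ≤ c 0` and `|Ñ_n ∖ S| ≥ 2`. -/
theorem min_cut_pathPolytope (n m : ℕ) (hn : 4 ≤ n) (hm : 2 ≤ m)
    (c : Fin m → ℕ) (hmono : StrictMono c)
    (hc2 : ∀ p, 2 ≤ c p) (hcn : ∀ p, c p ≤ n)
    (hCS : Set.range c ≠ {2, 3})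
    (S : Finset (Fin (n + 1))) (hSss : S ⊂ Finset.univ)
    (h0S : 0 ∈ S) (hnS : Fin.last n ∈ S) :
    ((∀ x ∈ pathPolytope n c,
        1 ≤ ∑ a ∈ (tA n).filter (fun a => a.1 ∈ S ∧ a.2 ∉ S), x a.1 a.2) ↔
      S.card ≤ c ⟨0, by omega⟩) ∧
    (IsFacetGE (pathPolytope n c)
        (fun x => ∑ a ∈ (tA n).filter (fun a => a.1 ∈ S ∧ a.2 ∉ S), x a.1 a.2) 1 ↔
      (3 ≤ S.card ∧ S.card ≤ c ⟨0, by omega⟩ ∧ 2 ≤ (Finset.univ \ S).card)) := by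
  have hn0 : n ≠ 0 := by omega
  have h01 : c ⟨0, by omega⟩ < c ⟨1, by omega⟩ := hmono (Fin.mk_lt_mk.2 Nat.zero_lt_one)
  have hmin : ∀ p, c ⟨0, by omega⟩ ≤ c p := fun p =>
    hmono.monotone (Fin.mk_le_of_le_val p.val.zero_le)
  simp only [← cutFun_apply]
  have hvalid : (∀ x ∈ pathPolytope n c, 1 ≤ cutFun S x) ↔ #S ≤ c ⟨0, by omega⟩ :=
    ⟨card_le_of_one_le_cutFun hn0 h0S hnS _ (hc2 _), fun h x =>
      one_le_cutFun h0S fun p => h.trans (hmin p)⟩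
  refine ⟨hvalid, fun H => ?_, fun H => ?_⟩
  · have hS := hvalid.1 H.1
    refine ⟨two_lt_card_of_isFacetGE hn0 h0S hnS H, hS, ?_⟩
    have h1 := card_sdiff_add_card_eq_card (subset_univ S)
    rw [card_univ, Fintype.card_fin] at h1
    have h2 := hcn ⟨1, by omega⟩
    omega
  · exact isFacetGE_cutFun hn0 h0S hnS hcn hmin h01 H.1 H.2.1
end
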